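/- Let μ be a Carleson measure on the open unit disc 𝔻. Then there exists an outer function E belonging to QA, whose boundary function log|E| belongs to VMO, such that the measure |E|μ (given by d(|E|μ)(z) = |E(z)| dμ(z)) is a vanishing Carleson measure. -/

import Mathlib

open MeasureTheory Filter Set Topology

noncomputable section

/-- The open unit disc in `ℂ`. -/
def unitDisc : Set ℂ := {z : ℂ | ‖z‖ < 1}

/-- The point `e^{iθ}` on the unit circle. -/
def circlePt (θ : ℝ) : ℂ := Complex.exp ((θ : ℂ) * Complex.I)

/-- The Carleson square based on the arc centered at `e^{iθ₀}` of normalized length `t`. -/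
def carlesonSquare (θ₀ t : ℝ) : Set ℂ :=
  {z : ℂ | z ∈ unitDisc ∧ 1 - t ≤ ‖z‖ ∧
    ∃ θ : ℝ, |θ - θ₀| ≤ Real.pi * t ∧ z = (‖z‖ : ℂ) * circlePt θ}

/-- `μ` is a Carleson measure. -/
def IsCarleson (μ : Measure ℂ) : Prop :=
  ∃ C : ℝ, 0 < C ∧ ∀ θ₀ t : ℝ, 0 < t → t ≤ 1 →
    μ (carlesonSquare θ₀ t) ≤ ENNReal.ofReal (C * t)

/-- `μ` is a vanishing Carleson measure. -/
def IsVanishingCarleson (μ : Measure ℂ) : Prop :=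
  IsCarleson μ ∧ ∀ ε : ℝ, 0 < ε → ∃ δ : ℝ, 0 < δ ∧ ∀ θ₀ t : ℝ, 0 < t → t < δ →
    μ (carlesonSquare θ₀ t) ≤ ENNReal.ofReal (ε * t)

/-- The measure `|E| μ`, i.e. `d(|E|μ)(z) = |E(z)| dμ(z)`. -/
def absDensity (E : ℂ → ℂ) (μ : Measure ℂ) : Measure ℂ :=
  μ.withDensity (fun z => ENNReal.ofReal ‖E z‖)

/-- Average of a boundary function (in the angle variable) over the arc
centered at `e^{iθ₀}` of normalized length `t`; `dm = dθ/(2π)`. -/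
def arcAvg (f : ℝ → ℂ) (θ₀ t : ℝ) : ℂ :=
  ((2 * Real.pi * t)⁻¹ : ℝ) •
    ∫ θ in Set.Ioo (θ₀ - Real.pi * t) (θ₀ + Real.pi * t), f θ

/-- Mean oscillation of a boundary function over the arc centered at `e^{iθ₀}`
of normalized length `t`. -/
def meanOsc (f : ℝ → ℂ) (θ₀ t : ℝ) : ℝ :=
  (2 * Real.pi * t)⁻¹ *
    ∫ θ in Set.Ioo (θ₀ - Real.pi * t) (θ₀ + Real.pi * t), ‖f θ - arcAvg f θ₀ t‖

/-- A (2π-periodic, integrable) boundary function has bounded mean oscillation. -/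
def IsBMO (f : ℝ → ℂ) : Prop :=
  (∀ θ : ℝ, f (θ + 2 * Real.pi) = f θ) ∧
  IntegrableOn f (Set.Ioc 0 (2 * Real.pi)) ∧
  ∃ C : ℝ, ∀ θ₀ t : ℝ, 0 < t → t ≤ 1 → meanOsc f θ₀ t ≤ C

/-- A boundary function has vanishing mean oscillation. -/
def IsVMO (f : ℝ → ℂ) : Prop :=
  IsBMO f ∧ ∀ ε : ℝ, 0 < ε → ∃ δ : ℝ, 0 < δ ∧
    ∀ θ₀ t : ℝ, 0 < t → t < δ → meanOsc f θ₀ t ≤ ε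

/-- The BMO seminorm of a boundary function. -/
def bmoSeminorm (f : ℝ → ℂ) : ℝ :=
  sSup {c : ℝ | ∃ θ₀ t : ℝ, 0 < t ∧ t ≤ 1 ∧ c = meanOsc f θ₀ t}

/-- `Fb` is the (a.e.) radial boundary function of `F`. -/
def HasRadialLimits (F : ℂ → ℂ) (Fb : ℝ → ℂ) : Prop :=
  ∀ᵐ θ ∂(volume.restrict (Set.Ioc 0 (2 * Real.pi))),
    Tendsto (fun r : ℝ => F ((r : ℂ) * circlePt θ))
      (nhdsWithin 1 (Set.Iio 1)) (nhds (Fb θ))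

/-- `F` is a bounded analytic function on the unit disc. -/
def MemHinf (F : ℂ → ℂ) : Prop :=
  DifferentiableOn ℂ F unitDisc ∧ ∃ M : ℝ, ∀ z ∈ unitDisc, ‖F z‖ ≤ M

/-- `F` belongs to `QA` with boundary function `Fb`: it is a bounded analytic
function on the disc whose radial boundary values are in VMO. -/
def MemQA (F : ℂ → ℂ) (Fb : ℝ → ℂ) : Prop :=
  MemHinf F ∧ HasRadialLimits F Fb ∧ IsVMO Fb

/-- `E` is an outer function. -/
def IsOuter (E : ℂ → ℂ) : Prop :=
  DifferentiableOn ℂ E unitDisc ∧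
  ∃ h : ℝ → ℝ, IntegrableOn h (Set.Ioc 0 (2 * Real.pi)) ∧ ∀ z ∈ unitDisc,
    E z = Complex.exp (((2 * Real.pi)⁻¹ : ℝ) • ∫ θ in Set.Ioc 0 (2 * Real.pi),
      ((circlePt θ + z) / (circlePt θ - z)) * (h θ : ℂ))

/-- The integral means appearing in the definition of the Hardy space `ℍ^p`. -/
def hardyIntegral (p : ℝ) (F : ℂ → ℂ) (r : ℝ) : ℝ :=
  ∫ θ in Set.Ioc 0 (2 * Real.pi), ‖F ((r : ℂ) * circlePt θ)‖ ^ p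

/-- `F` belongs to the Hardy space `ℍ^p`, `0 < p < ∞`. -/
def MemHardy (p : ℝ) (F : ℂ → ℂ) : Prop :=
  DifferentiableOn ℂ F unitDisc ∧
  ∃ M : ℝ, ∀ r : ℝ, 0 < r → r < 1 → hardyIntegral p F r ≤ M

/-- `F` belongs to `BMOA` with boundary function `Fb`. -/
def MemBMOA (F : ℂ → ℂ) (Fb : ℝ → ℂ) : Prop :=
  MemHardy 2 F ∧ HasRadialLimits F Fb ∧ IsBMO Fb

/-- `F` belongs to `VMOA` with boundary function `Fb`. -/
def MemVMOA (F : ℂ → ℂ) (Fb : ℝ → ℂ) : Prop :=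
  MemHardy 2 F ∧ HasRadialLimits F Fb ∧ IsVMO Fb

/-- The generalized Volterra operator `T_G(F)(z) = ∫₀^z F(w) G'(w) dw`. -/
def volterra (G F : ℂ → ℂ) (z : ℂ) : ℂ :=
  ∫ t in (0:ℝ)..1, z * F ((t : ℂ) * z) * deriv G ((t : ℂ) * z)

theorem norm_circlePt (θ : ℝ) : ‖circlePt θ‖ = 1 := Complex.norm_exp_ofReal_mul_I θ

@[fun_prop]
theorem continuous_circlePt : Continuous circlePt := by
  unfold circlePt; fun_prop

theorem circlePt_periodic : Function.Periodic circlePt (2 * Real.pi) := fun θ => by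
  simp only [circlePt]
  push_cast
  rw [add_mul, Complex.exp_periodic]

theorem norm_circlePt_sub_le (θ θ₀ : ℝ) : ‖circlePt θ - circlePt θ₀‖ ≤ |θ - θ₀| := by
  have h : circlePt θ - circlePt θ₀ =
      circlePt θ₀ * (Complex.exp (Complex.I * ((θ - θ₀ : ℝ) : ℂ)) - 1) := by
    rw [mul_sub, mul_one, circlePt, circlePt, ← Complex.exp_add]
    congr 2; push_cast; ring
  rw [h, norm_mul, norm_circlePt, one_mul]
  exact Real.norm_exp_I_mul_ofReal_sub_one_le

theorem circleMap_zero_one (θ : ℝ) : circleMap 0 1 θ = circlePt θ := by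
  simp [circleMap, circlePt]

/-- The Poisson kernel of the unit disc, in the angle variable. -/
def discPoisson (z : ℂ) (θ : ℝ) : ℝ := (1 - ‖z‖ ^ 2) / ‖circlePt θ - z‖ ^ 2

theorem circlePt_sub_ne_zero {z : ℂ} (hz : ‖z‖ < 1) (θ : ℝ) : circlePt θ - z ≠ 0 := by
  intro h
  rw [sub_eq_zero] at h
  rw [← h, norm_circlePt] at hz
  exact lt_irrefl _ hz

theorem discPoisson_nonneg {z : ℂ} (hz : ‖z‖ < 1) (θ : ℝ) : 0 ≤ discPoisson z θ := by
  unfold discPoisson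
  have : 0 ≤ 1 - ‖z‖ ^ 2 := by nlinarith [norm_nonneg z]
  positivity

theorem continuous_discPoisson {z : ℂ} (hz : ‖z‖ < 1) : Continuous (discPoisson z) := by
  unfold discPoisson
  refine Continuous.div (by fun_prop) (by fun_prop) fun θ => ?_
  have := circlePt_sub_ne_zero hz θ
  positivity

theorem discPoisson_periodic (z : ℂ) : Function.Periodic (discPoisson z) (2 * Real.pi) := fun θ => by
  simp only [discPoisson, circlePt_periodic θ]

theorem discPoisson_eq_poissonKernel (z : ℂ) (θ : ℝ) :
    discPoisson z θ = poissonKernel 0 z (circlePt θ) := by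
  simp [discPoisson, poissonKernel, norm_circlePt]

theorem diffContOnCl_ball_one {f : ℂ → ℂ} {R : ℝ} (hR : 1 < R)
    (hf : DifferentiableOn ℂ f (Metric.ball 0 R)) : DiffContOnCl ℂ f (Metric.ball 0 1) := by
  refine DifferentiableOn.diffContOnCl (hf.mono ?_)
  rw [closure_ball _ one_ne_zero]
  exact Metric.closedBall_subset_ball hR

theorem continuous_comp_circlePt {f : ℂ → ℂ} {R : ℝ} (hR : 1 < R)
    (hf : DifferentiableOn ℂ f (Metric.ball 0 R)) : Continuous fun θ => f (circlePt θ) := by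
  refine hf.continuousOn.comp_continuous continuous_circlePt fun θ => ?_
  simpa [norm_circlePt] using hR

/-- The Poisson formula on the unit circle. -/
theorem integral_discPoisson_smul {f : ℂ → ℂ} {R : ℝ} (hR : 1 < R)
    (hf : DifferentiableOn ℂ f (Metric.ball 0 R)) {z : ℂ} (hz : ‖z‖ < 1) :
    ∫ θ in (0 : ℝ)..2 * Real.pi, (discPoisson z θ : ℂ) * f (circlePt θ) = 2 * Real.pi * f z := by
  have h := (diffContOnCl_ball_one hR hf).circleAverage_poissonKernel_smul (w := z) (by simpa using hz)
  rw [Real.circleAverage_def, inv_smul_eq_iff₀ (by positivity)] at h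
  simp only [Pi.smul_apply', circleMap_zero_one, ← discPoisson_eq_poissonKernel,
    Complex.real_smul] at h
  rw [h]; push_cast; ring

theorem integral_discPoisson {z : ℂ} (hz : ‖z‖ < 1) :
    ∫ θ in (0 : ℝ)..2 * Real.pi, discPoisson z θ = 2 * Real.pi := by
  have h := integral_discPoisson_smul (f := fun _ => 1) one_lt_two (by fun_prop) hz
  simp only [mul_one, intervalIntegral.integral_ofReal] at h
  exact_mod_cast h

/-- The Schwarz integral formula, for a function which is real at the origin. -/
theorem integral_herglotz_mul_re {f : ℂ → ℂ} {R : ℝ} (hR : 1 < R)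
    (hf : DifferentiableOn ℂ f (Metric.ball 0 R)) (h0 : (f 0).im = 0) {z : ℂ} (hz : ‖z‖ < 1) :
    ∫ θ in (0 : ℝ)..2 * Real.pi,
      ((circlePt θ + z) / (circlePt θ - z)) * ((f (circlePt θ)).re : ℂ) = 2 * Real.pi * f z := by
  have hc := continuous_comp_circlePt hR hf
  have hne := circlePt_sub_ne_zero hz
  have hP := integral_discPoisson_smul hR hf hz
  have hM := integral_discPoisson_smul hR hf (z := 0) (by simp)
  have hC := (diffContOnCl_ball_one hR hf)
  rw [← abs_one (α := ℝ)] at hC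
  replace hC := hC.circleAverage_smul_div (w := z) (by simpa using hz)
  rw [Real.circleAverage_def, inv_smul_eq_iff₀ (by positivity)] at hC
  simp only [circleMap_zero_one, sub_zero, smul_eq_mul, Complex.real_smul] at hC
  have hM' : ∫ θ in (0 : ℝ)..2 * Real.pi, f (circlePt θ) = 2 * Real.pi * f 0 := by
    rw [← hM]; simp [discPoisson, norm_circlePt]
  have hA : ∫ θ in (0 : ℝ)..2 * Real.pi, ((circlePt θ + z) / (circlePt θ - z)) * f (circlePt θ)
      = 2 * Real.pi * (2 * f z - f 0) := by
    have : ∀ θ, ((circlePt θ + z) / (circlePt θ - z)) * f (circlePt θ) =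
        2 * (circlePt θ / (circlePt θ - z) * f (circlePt θ)) - f (circlePt θ) := fun θ => by
      field_simp [hne θ]; ring
    simp_rw [this]
    rw [intervalIntegral.integral_sub, intervalIntegral.integral_const_mul, hC, hM']
    · push_cast; ring
    · refine Continuous.intervalIntegrable ?_ _ _
      exact continuous_const.mul ((Continuous.div (by fun_prop) (by fun_prop) hne).mul hc)
    · exact hc.intervalIntegrable _ _
  have hSc : Continuous fun θ => (circlePt θ + z) / (circlePt θ - z) :=
    Continuous.div (by fun_prop) (by fun_prop) hne
  have hPc : Continuous fun θ => (discPoisson z θ : ℂ) :=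
    Complex.continuous_ofReal.comp (continuous_discPoisson hz)
  have hB : ∫ θ in (0 : ℝ)..2 * Real.pi,
      (starRingEnd ℂ) (2 * ((discPoisson z θ : ℂ) * f (circlePt θ)) -
        (circlePt θ + z) / (circlePt θ - z) * f (circlePt θ)) =
      2 * Real.pi * (starRingEnd ℂ) (f 0) := by
    rw [intervalIntegral.intervalIntegral_conj, intervalIntegral.integral_sub, intervalIntegral.integral_const_mul,
      hP, hA]
    · simp only [map_sub, map_mul, map_ofNat, Complex.conj_ofReal]; ring
    · exact (continuous_const.mul (hPc.mul hc)).intervalIntegrable _ _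
    · exact (hSc.mul hc).intervalIntegrable _ _
  have key : ∀ θ, ((circlePt θ + z) / (circlePt θ - z)) * ((f (circlePt θ)).re : ℂ) =
      2⁻¹ * (((circlePt θ + z) / (circlePt θ - z)) * f (circlePt θ) +
      (starRingEnd ℂ) (2 * ((discPoisson z θ : ℂ) * f (circlePt θ)) -
        (circlePt θ + z) / (circlePt θ - z) * f (circlePt θ))) := fun θ => by
    have h1 : (discPoisson z θ) = ((circlePt θ + z) / (circlePt θ - z)).re := by
      rw [discPoisson_eq_poissonKernel, poissonKernel_eq_re_herglotzRieszKernel]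
      simp [herglotzRieszKernel]
    have h2 := Complex.add_conj ((circlePt θ + z) / (circlePt θ - z))
    have h3 := Complex.add_conj (f (circlePt θ))
    rw [← h1] at h2
    push_cast at h2 h3
    simp only [map_sub, map_mul, map_ofNat, Complex.conj_ofReal]
    linear_combination (-(circlePt θ + z) / (circlePt θ - z) / 2) * h3 +
      (starRingEnd ℂ) (f (circlePt θ)) / 2 * h2
  simp_rw [key]
  rw [intervalIntegral.integral_const_mul, intervalIntegral.integral_add, hA, hB]
  · have : (starRingEnd ℂ) (f 0) = f 0 := Complex.conj_eq_iff_im.2 h0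
    rw [this]; ring
  · exact (hSc.mul hc).intervalIntegrable _ _
  · exact (Complex.continuous_conj.comp
      ((continuous_const.mul (hPc.mul hc)).sub (hSc.mul hc))).intervalIntegrable _ _

section SumIntegrable

variable {α : Type*} [MeasurableSpace α] {μ : Measure α} {F : ℕ → α → ℂ}

theorem lintegral_tsum_enorm_ne_top (hint : ∀ k, Integrable (F k) μ)
    (hsum : Summable fun k => ∫ a, ‖F k a‖ ∂μ) : ∫⁻ a, ∑' k, ‖F k a‖ₑ ∂μ ≠ ⊤ := by
  rw [lintegral_tsum fun k => (hint k).1.enorm]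
  have : ∀ k, ∫⁻ a, ‖F k a‖ₑ ∂μ = ENNReal.ofReal (∫ a, ‖F k a‖ ∂μ) := fun k => by
    rw [ofReal_integral_norm_eq_lintegral_enorm (hint k)]
  simp_rw [this]
  rw [← ENNReal.ofReal_tsum_of_nonneg (fun k => integral_nonneg fun a => norm_nonneg _) hsum]
  exact ENNReal.ofReal_ne_top

theorem ae_summable_norm (hint : ∀ k, Integrable (F k) μ)
    (hsum : Summable fun k => ∫ a, ‖F k a‖ ∂μ) : ∀ᵐ a ∂μ, Summable fun k => ‖F k a‖ := by
  have h := ae_lt_top' (AEMeasurable.tsum fun k => (hint k).1.enorm)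
    (lintegral_tsum_enorm_ne_top hint hsum)
  filter_upwards [h] with a ha
  have := ENNReal.summable_toReal ha.ne
  simpa using this

theorem integrable_tsum_norm (hint : ∀ k, Integrable (F k) μ)
    (hsum : Summable fun k => ∫ a, ‖F k a‖ ∂μ) : Integrable (fun a => ∑' k, ‖F k a‖) μ := by
  have h := integrable_toReal_of_lintegral_ne_top (AEMeasurable.tsum fun k => (hint k).1.enorm)
    (lintegral_tsum_enorm_ne_top hint hsum)
  refine h.congr ?_
  filter_upwards with a
  rw [ENNReal.tsum_toReal_eq (by simp)]
  simp

theorem integrable_tsum (hint : ∀ k, Integrable (F k) μ)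
    (hsum : Summable fun k => ∫ a, ‖F k a‖ ∂μ) : Integrable (fun a => ∑' k, F k a) μ := by
  have hs := ae_summable_norm hint hsum
  refine (integrable_tsum_norm hint hsum).mono' ?_ ?_
  · refine aestronglyMeasurable_of_tendsto_ae atTop
      (f := fun n a => ∑ k ∈ Finset.range n, F k a) (fun n => ?_) ?_
    · exact Finset.aestronglyMeasurable_fun_sum _ fun k _ => (hint k).1
    · filter_upwards [hs] with a ha using ha.of_norm.hasSum.tendsto_sum_nat
  · filter_upwards [hs] with a ha using norm_tsum_le_tsum_norm ha

end SumIntegrable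

section MeanOscillation

/-- The interval of angles of the arc centered at `e^{iθ₀}` of normalized length `t`. -/
abbrev angleArc (θ₀ t : ℝ) : Set ℝ := Set.Ioo (θ₀ - Real.pi * t) (θ₀ + Real.pi * t)

theorem volume_real_angleArc (θ₀ : ℝ) {t : ℝ} (ht : 0 < t) :
    volume.real (angleArc θ₀ t) = 2 * Real.pi * t := by
  have := mul_pos Real.pi_pos ht
  rw [Real.volume_real_Ioo_of_le (by linarith)]; ring

theorem arcAvg_const (c : ℂ) (θ₀ : ℝ) {t : ℝ} (ht : 0 < t) : arcAvg (fun _ => c) θ₀ t = c := by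
  have h : 2 * Real.pi * t ≠ 0 := by positivity
  rw [arcAvg, setIntegral_const, volume_real_angleArc θ₀ ht, smul_smul, inv_mul_cancel₀ h, one_smul]

theorem integrableOn_const_angleArc (c : ℂ) (θ₀ t : ℝ) :
    IntegrableOn (fun _ => c) (angleArc θ₀ t) :=
  integrableOn_const (by simp)

theorem norm_arcAvg_sub_le {f : ℝ → ℂ} {θ₀ t : ℝ} (ht : 0 < t)
    (hf : IntegrableOn f (angleArc θ₀ t)) (c : ℂ) :
    ‖arcAvg f θ₀ t - c‖ ≤ (2 * Real.pi * t)⁻¹ * ∫ θ in angleArc θ₀ t, ‖f θ - c‖ := by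
  have hpos : 0 < 2 * Real.pi * t := by positivity
  have : arcAvg f θ₀ t - c = ((2 * Real.pi * t)⁻¹ : ℝ) • ∫ θ in angleArc θ₀ t, (f θ - c) := by
    conv_lhs => rw [← arcAvg_const c θ₀ ht]
    rw [arcAvg, arcAvg, ← smul_sub, integral_sub hf (integrableOn_const_angleArc c θ₀ t)]
  rw [this, norm_smul, Real.norm_of_nonneg (by positivity)]
  gcongr
  exact norm_integral_le_integral_norm _

theorem meanOsc_nonneg (f : ℝ → ℂ) (θ₀ : ℝ) {t : ℝ} (ht : 0 < t) : 0 ≤ meanOsc f θ₀ t := by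
  unfold meanOsc
  have : 0 ≤ ∫ θ in angleArc θ₀ t, ‖f θ - arcAvg f θ₀ t‖ := integral_nonneg fun _ => norm_nonneg _
  positivity

theorem meanOsc_le_two_mul {f : ℝ → ℂ} {θ₀ t : ℝ} (ht : 0 < t)
    (hf : IntegrableOn f (angleArc θ₀ t)) (c : ℂ) :
    meanOsc f θ₀ t ≤ 2 * ((2 * Real.pi * t)⁻¹ * ∫ θ in angleArc θ₀ t, ‖f θ - c‖) := by
  have hpos : 0 < 2 * Real.pi * t := by positivity
  have hfc : IntegrableOn (fun θ => ‖f θ - c‖) (angleArc θ₀ t) :=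
    (hf.sub (integrableOn_const_angleArc c θ₀ t)).norm
  have hcst : IntegrableOn (fun _ => ‖arcAvg f θ₀ t - c‖) (angleArc θ₀ t) :=
    integrableOn_const (by simp)
  have h1 : ∫ θ in angleArc θ₀ t, ‖f θ - arcAvg f θ₀ t‖ ≤
      (∫ θ in angleArc θ₀ t, ‖f θ - c‖) + 2 * Real.pi * t * ‖arcAvg f θ₀ t - c‖ := by
    rw [← volume_real_angleArc θ₀ ht, ← smul_eq_mul (a := volume.real _), ← setIntegral_const,
      ← integral_add hfc hcst]
    refine integral_mono (hf.sub (integrableOn_const_angleArc _ θ₀ t)).norm (hfc.add hcst)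
      fun θ => ?_
    have := norm_sub_le (f θ - c) (arcAvg f θ₀ t - c)
    simpa using this
  have h2 := norm_arcAvg_sub_le ht hf c
  unfold meanOsc
  calc _ ≤ (2 * Real.pi * t)⁻¹ * ((∫ θ in angleArc θ₀ t, ‖f θ - c‖)
        + 2 * Real.pi * t * ‖arcAvg f θ₀ t - c‖) := by gcongr
    _ = (2 * Real.pi * t)⁻¹ * (∫ θ in angleArc θ₀ t, ‖f θ - c‖) + ‖arcAvg f θ₀ t - c‖ := by
      field_simp
    _ ≤ _ := by linarith

theorem meanOsc_comp_le {f : ℝ → ℂ} {φ : ℂ → ℂ} {θ₀ t : ℝ} (ht : 0 < t)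
    (hf : IntegrableOn f (angleArc θ₀ t)) (hφf : IntegrableOn (fun θ => φ (f θ)) (angleArc θ₀ t))
    (h : ∀ θ, ‖φ (f θ) - φ (arcAvg f θ₀ t)‖ ≤ ‖f θ - arcAvg f θ₀ t‖) :
    meanOsc (fun θ => φ (f θ)) θ₀ t ≤ 2 * meanOsc f θ₀ t := by
  have hpos : 0 < 2 * Real.pi * t := by positivity
  refine (meanOsc_le_two_mul ht hφf (φ (arcAvg f θ₀ t))).trans ?_
  unfold meanOsc
  gcongr ?_ * (?_ * ?_)
  exact integral_mono (hφf.sub (integrableOn_const_angleArc _ θ₀ t)).norm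
    (hf.sub (integrableOn_const_angleArc _ θ₀ t)).norm h

theorem re_arcAvg_nonneg {f : ℝ → ℂ} (hre : ∀ θ, 0 ≤ (f θ).re) {θ₀ t : ℝ} (ht : 0 < t)
    (hf : IntegrableOn f (angleArc θ₀ t)) : 0 ≤ (arcAvg f θ₀ t).re := by
  have hpos : 0 < 2 * Real.pi * t := by positivity
  rw [arcAvg, Complex.smul_re]
  have h : (∫ θ in angleArc θ₀ t, f θ).re = ∫ θ in angleArc θ₀ t, (f θ).re :=
    (integral_re hf).symm
  have h2 : 0 ≤ ∫ θ in angleArc θ₀ t, (f θ).re := integral_nonneg hre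
  rw [h, smul_eq_mul]
  positivity

theorem meanOsc_tsum_le {f : ℕ → ℝ → ℂ} {θ₀ t : ℝ} (ht : 0 < t)
    (hint : ∀ k, IntegrableOn (f k) (angleArc θ₀ t))
    (hsum : Summable fun k => ∫ θ in angleArc θ₀ t, ‖f k θ‖) :
    meanOsc (fun θ => ∑' k, f k θ) θ₀ t ≤ ∑' k, meanOsc (f k) θ₀ t := by
  have hpos : 0 < 2 * Real.pi * t := by positivity
  have havg : HasSum (fun k => arcAvg (f k) θ₀ t) (arcAvg (fun θ => ∑' k, f k θ) θ₀ t) :=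
    (hasSum_integral_of_summable_integral_norm hint hsum).const_smul ((2 * Real.pi * t)⁻¹ : ℝ)
  have hint' : ∀ k, IntegrableOn (fun θ => f k θ - arcAvg (f k) θ₀ t) (angleArc θ₀ t) :=
    fun k => (hint k).sub (integrableOn_const_angleArc _ θ₀ t)
  have hosc : Summable fun k => meanOsc (f k) θ₀ t := by
    refine Summable.of_nonneg_of_le (fun k => meanOsc_nonneg _ _ ht)
      (fun k => meanOsc_le_two_mul ht (hint k) 0) ?_
    simp only [sub_zero]
    exact (hsum.mul_left _).mul_left _
  have hsum' : Summable fun k => ∫ θ in angleArc θ₀ t, ‖f k θ - arcAvg (f k) θ₀ t‖ := by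
    have := hosc.mul_left (2 * Real.pi * t)
    refine this.congr fun k => ?_
    rw [meanOsc, mul_inv_cancel_left₀ hpos.ne']
  have h1 : ∫ θ in angleArc θ₀ t, ‖(∑' k, f k θ) - arcAvg (fun θ => ∑' k, f k θ) θ₀ t‖ ≤
      ∑' k, ∫ θ in angleArc θ₀ t, ‖f k θ - arcAvg (f k) θ₀ t‖ := by
    rw [integral_tsum_of_summable_integral_norm (fun k => (hint' k).norm) (by simpa using hsum')]
    refine integral_mono_ae
      ((integrable_tsum hint hsum).sub (integrableOn_const_angleArc _ θ₀ t)).norm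
      (integrable_tsum_norm hint' hsum') ?_
    filter_upwards [ae_summable_norm hint hsum, ae_summable_norm hint' hsum'] with θ h1 h2
    rw [← havg.tsum_eq, ← h1.of_norm.tsum_sub havg.summable]
    exact norm_tsum_le_tsum_norm h2
  unfold meanOsc
  rw [tsum_mul_left]
  gcongr

theorem angleArc_subset {θ₀ t : ℝ} (ht : t ≤ 1) :
    angleArc θ₀ t ⊆ Set.Ioc (θ₀ - Real.pi) (θ₀ - Real.pi + 2 * Real.pi) := by
  have : Real.pi * t ≤ Real.pi := by nlinarith [Real.pi_pos]
  intro θ hθ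
  exact ⟨by linarith [hθ.1], by linarith [hθ.2]⟩

theorem Function.Periodic.integrableOn_angleArc {f : ℝ → ℂ} (hper : Function.Periodic f (2 * Real.pi))
    (hf : IntegrableOn f (Set.Ioc 0 (2 * Real.pi))) (θ₀ t : ℝ) :
    IntegrableOn f (angleArc θ₀ t) := by
  have h : IntervalIntegrable f volume 0 (2 * Real.pi) :=
    (intervalIntegrable_iff_integrableOn_Ioc_of_le (by positivity)).2 hf
  have := hper.intervalIntegrable₀ (by positivity) h (θ₀ - Real.pi * t) (θ₀ + Real.pi * t)
  exact this.1.mono_set Ioo_subset_Ioc_self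

/-- The filter of arcs whose length tends to zero. -/
def smallArcs : Filter (ℝ × ℝ) := ⊤ ×ˢ 𝓝[>] (0 : ℝ)

theorem eventually_smallArcs {p : ℝ → ℝ → Prop} :
    (∀ᶠ x in smallArcs, p x.1 x.2) ↔ ∃ δ : ℝ, 0 < δ ∧ ∀ θ₀ t : ℝ, 0 < t → t < δ → p θ₀ t := by
  have hb : (𝓝[>] (0 : ℝ)).HasBasis (fun δ => 0 < δ) fun δ => Set.Ioo 0 δ := nhdsGT_basis 0
  have := (hasBasis_top (α := ℝ)).prod hb
  rw [smallArcs, this.eventually_iff]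
  constructor
  · rintro ⟨⟨_, δ⟩, ⟨_, hδ⟩, h⟩
    exact ⟨δ, hδ, fun θ₀ t h0 h1 => h (x := (θ₀, t)) ⟨trivial, h0, h1⟩⟩
  · rintro ⟨δ, hδ, h⟩
    exact ⟨⟨(), δ⟩, ⟨trivial, hδ⟩, fun x hx => h _ _ hx.2.1 hx.2.2⟩

theorem isVMO_iff {f : ℝ → ℂ} :
    IsVMO f ↔ IsBMO f ∧ Tendsto (fun x : ℝ × ℝ => meanOsc f x.1 x.2) smallArcs (𝓝 0) := by
  have hpos : ∀ᶠ x : ℝ × ℝ in smallArcs, 0 < x.2 :=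
    (eventually_smallArcs (p := fun _ t => 0 < t)).2 ⟨1, one_pos, fun _ _ h _ => h⟩
  refine and_congr_right fun _ => ?_
  constructor
  · intro h
    rw [Metric.tendsto_nhds]
    intro ε hε
    have := (eventually_smallArcs (p := fun θ₀ t => meanOsc f θ₀ t ≤ ε / 2)).2 (h (ε / 2) (by positivity))
    filter_upwards [this, hpos] with x hx h0
    rw [Real.dist_0_eq_abs, abs_of_nonneg (meanOsc_nonneg _ _ h0)]
    linarith
  · intro h ε hε
    exact (eventually_smallArcs (p := fun θ₀ t => meanOsc f θ₀ t ≤ ε)).1 (h.eventually_le_const hε)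

theorem tendsto_meanOsc_comp_circlePt {g : ℂ → ℂ} (hg : ContinuousOn g (Metric.sphere 0 1)) :
    Tendsto (fun x : ℝ × ℝ => meanOsc (fun θ => g (circlePt θ)) x.1 x.2) smallArcs (𝓝 0) := by
  have hmem : ∀ θ, circlePt θ ∈ Metric.sphere (0 : ℂ) 1 := fun θ => by simp [norm_circlePt]
  have hcont : Continuous fun θ => g (circlePt θ) := hg.comp_continuous continuous_circlePt hmem
  have huc := (isCompact_sphere (0 : ℂ) 1).uniformContinuousOn_of_continuous hg
  have hpos : ∀ᶠ x : ℝ × ℝ in smallArcs, 0 < x.2 :=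
    (eventually_smallArcs (p := fun _ t => 0 < t)).2 ⟨1, one_pos, fun _ _ h _ => h⟩
  rw [Metric.tendsto_nhds]
  intro ε hε
  obtain ⟨δ, hδ, h⟩ := Metric.uniformContinuousOn_iff.1 huc (ε / 4) (by positivity)
  have := (eventually_smallArcs
    (p := fun θ₀ t => meanOsc (fun θ => g (circlePt θ)) θ₀ t ≤ ε / 2)).2
    ⟨δ / Real.pi, by positivity, fun θ₀ t h0 h1 => by
      have hint : IntegrableOn (fun θ => g (circlePt θ)) (angleArc θ₀ t) :=
        (hcont.integrableOn_Icc (a := θ₀ - Real.pi * t) (b := θ₀ + Real.pi * t)).mono_set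
          Ioo_subset_Icc_self
      refine (meanOsc_le_two_mul h0 hint (g (circlePt θ₀))).trans ?_
      have hle : ∫ θ in angleArc θ₀ t, ‖g (circlePt θ) - g (circlePt θ₀)‖ ≤
          ∫ θ in angleArc θ₀ t, ε / 4 := by
        refine setIntegral_mono_on (hint.sub (integrableOn_const_angleArc _ θ₀ t)).norm
          (integrableOn_const (by simp)) measurableSet_Ioo fun θ hθ => ?_
        rw [← dist_eq_norm]
        refine (h _ (hmem θ) _ (hmem θ₀) ?_).le
        rw [dist_eq_norm]
        refine (norm_circlePt_sub_le θ θ₀).trans_lt ?_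
        have : Real.pi * t < δ := by rwa [lt_div_iff₀' Real.pi_pos] at h1
        exact lt_of_lt_of_le (abs_lt.2 ⟨by linarith [hθ.1], by linarith [hθ.2]⟩) this.le
      rw [setIntegral_const, volume_real_angleArc θ₀ h0, smul_eq_mul] at hle
      have hpos : 0 < 2 * Real.pi * t := by positivity
      calc _ ≤ 2 * ((2 * Real.pi * t)⁻¹ * (2 * Real.pi * t * (ε / 4))) := by gcongr
        _ = ε / 2 := by field_simp; ring⟩
  filter_upwards [this, hpos] with x hx h0
  rw [Real.dist_0_eq_abs, abs_of_nonneg (meanOsc_nonneg _ _ h0)]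
  linarith

end MeanOscillation

section Garsia

variable {f : ℂ → ℂ} {R κ : ℝ}

/-- The Garsia seminorm of an analytic function is controlled by the sup norm of its imaginary
part. -/
theorem integral_discPoisson_mul_norm_sq_le (hR : 1 < R)
    (hf : DifferentiableOn ℂ f (Metric.ball 0 R)) (him : ∀ z ∈ Metric.ball 0 R, |(f z).im| ≤ κ)
    {z : ℂ} (hz : ‖z‖ < 1) :
    ∫ θ in (0 : ℝ)..2 * Real.pi, discPoisson z θ * ‖f (circlePt θ) - f z‖ ^ 2 ≤
      16 * Real.pi * κ ^ 2 := by
  have hPc := continuous_discPoisson hz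
  have hg : DifferentiableOn ℂ (fun w => (f w - f z) ^ 2) (Metric.ball 0 R) :=
    (hf.sub_const _).pow 2
  have hgc := continuous_comp_circlePt hR hg
  have hfc := continuous_comp_circlePt hR hf
  have h0 := integral_discPoisson_smul hR hg hz
  simp only [sub_self, ne_eq, OfNat.ofNat_ne_zero, not_false_eq_true, zero_pow, mul_zero] at h0
  have h1 : ∫ θ in (0 : ℝ)..2 * Real.pi,
      discPoisson z θ * ((f (circlePt θ) - f z) ^ 2).re = 0 := by
    have hc : Continuous fun θ => (discPoisson z θ : ℂ) * (f (circlePt θ) - f z) ^ 2 :=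
      (Complex.continuous_ofReal.comp hPc).mul hgc
    have := Complex.reCLM.intervalIntegral_comp_comm (hc.intervalIntegrable (μ := volume) 0 (2 * Real.pi))
    simpa [h0] using this
  have hmem : ∀ θ, circlePt θ ∈ Metric.ball (0 : ℂ) R := fun θ => by simpa [norm_circlePt] using hR
  have hzmem : z ∈ Metric.ball (0 : ℂ) R := by simpa using hz.trans hR
  have hle : ∀ θ, discPoisson z θ * ‖f (circlePt θ) - f z‖ ^ 2 ≤
      discPoisson z θ * ((f (circlePt θ) - f z) ^ 2).re + discPoisson z θ * (8 * κ ^ 2) := by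
    intro θ
    rw [← mul_add]
    refine mul_le_mul_of_nonneg_left ?_ (discPoisson_nonneg hz θ)
    rw [Complex.sq_norm, Complex.normSq_apply, sq (f _ - f z), Complex.mul_re]
    have h1 := abs_le.1 (him _ (hmem θ))
    have h2 := abs_le.1 (him _ hzmem)
    have h3 : ((f (circlePt θ) - f z).im) ^ 2 ≤ (2 * κ) ^ 2 := by
      refine sq_le_sq' ?_ ?_ <;> simp only [Complex.sub_im] <;> linarith
    nlinarith
  calc _ ≤ ∫ θ in (0 : ℝ)..2 * Real.pi,
        (discPoisson z θ * ((f (circlePt θ) - f z) ^ 2).re + discPoisson z θ * (8 * κ ^ 2)) := by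
        refine intervalIntegral.integral_mono (by positivity) ?_ ?_ hle
        · exact (hPc.mul ((hfc.sub continuous_const).norm.pow 2)).intervalIntegrable _ _
        · exact ((hPc.mul (Complex.continuous_re.comp hgc)).add
            (hPc.mul continuous_const)).intervalIntegrable _ _
    _ = 16 * Real.pi * κ ^ 2 := by
        rw [intervalIntegral.integral_add, h1, intervalIntegral.integral_mul_const,
          integral_discPoisson hz]
        · ring
        · exact (hPc.mul (Complex.continuous_re.comp hgc)).intervalIntegrable _ _
        · exact (hPc.mul continuous_const).intervalIntegrable _ _

theorem one_le_discPoisson_of_mem_angleArc {θ₀ t θ : ℝ} (ht : 0 < t) (ht1 : t ≤ 1)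
    (hθ : θ ∈ angleArc θ₀ t) :
    1 ≤ 25 * t * discPoisson (((1 - t : ℝ) : ℂ) * circlePt θ₀) θ := by
  have hn : ‖((1 - t : ℝ) : ℂ) * circlePt θ₀‖ = 1 - t := by
    rw [norm_mul, norm_circlePt, mul_one, Complex.norm_real, Real.norm_of_nonneg (by linarith)]
  have hz : ‖((1 - t : ℝ) : ℂ) * circlePt θ₀‖ < 1 := by rw [hn]; linarith
  have hd : ‖circlePt θ - ((1 - t : ℝ) : ℂ) * circlePt θ₀‖ ≤ 5 * t := by
    have h1 : circlePt θ - ((1 - t : ℝ) : ℂ) * circlePt θ₀ =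
        (circlePt θ - circlePt θ₀) + (t : ℂ) * circlePt θ₀ := by push_cast; ring
    have h2 : |θ - θ₀| ≤ Real.pi * t := abs_le.2 ⟨by linarith [hθ.1], by linarith [hθ.2]⟩
    have h3 : Real.pi * t ≤ 4 * t := by nlinarith [Real.pi_lt_four]
    calc _ ≤ ‖circlePt θ - circlePt θ₀‖ + ‖(t : ℂ) * circlePt θ₀‖ := by rw [h1]; exact norm_add_le _ _
      _ ≤ 4 * t + t := by
        gcongr
        · exact (norm_circlePt_sub_le θ θ₀).trans (h2.trans h3)
        · rw [norm_mul, norm_circlePt, mul_one, Complex.norm_real, Real.norm_of_nonneg ht.le]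
      _ = 5 * t := by ring
  have hpos : 0 < ‖circlePt θ - ((1 - t : ℝ) : ℂ) * circlePt θ₀‖ :=
    norm_pos_iff.2 (circlePt_sub_ne_zero hz θ)
  have hd2 := pow_le_pow_left₀ hpos.le hd 2
  rw [discPoisson, hn, ← mul_div_assoc, le_div_iff₀ (by positivity)]
  nlinarith [mul_nonneg (sq_nonneg t) (sub_nonneg.2 ht1)]

theorem meanOsc_le_of_im_le (hR : 1 < R) (hκ : 0 < κ)
    (hf : DifferentiableOn ℂ f (Metric.ball 0 R)) (him : ∀ z ∈ Metric.ball 0 R, |(f z).im| ≤ κ)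
    {θ₀ t : ℝ} (ht : 0 < t) (ht1 : t ≤ 1) :
    meanOsc (fun θ => f (circlePt θ)) θ₀ t ≤ 201 * κ := by
  set z : ℂ := ((1 - t : ℝ) : ℂ) * circlePt θ₀ with hzdef
  have hz : ‖z‖ < 1 := by
    rw [hzdef, norm_mul, norm_circlePt, mul_one, Complex.norm_real, Real.norm_of_nonneg (by linarith)]
    linarith
  have hfc := continuous_comp_circlePt hR hf
  have hPc := continuous_discPoisson hz
  have hint {E : Type} [NormedAddCommGroup E] {g : ℝ → E} (hg : Continuous g) :
      IntegrableOn g (angleArc θ₀ t) :=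
    (hg.integrableOn_Icc (a := θ₀ - Real.pi * t) (b := θ₀ + Real.pi * t)).mono_set
      Ioo_subset_Icc_self
  have hGc : Continuous fun θ => discPoisson z θ * ‖f (circlePt θ) - f z‖ ^ 2 :=
    hPc.mul ((hfc.sub continuous_const).norm.pow 2)
  have hper : Function.Periodic (fun θ => discPoisson z θ * ‖f (circlePt θ) - f z‖ ^ 2)
      (2 * Real.pi) := fun θ => by
    simp only [discPoisson_periodic z θ, circlePt_periodic θ]
  have hgarsia : ∫ θ in angleArc θ₀ t, discPoisson z θ * ‖f (circlePt θ) - f z‖ ^ 2 ≤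
      16 * Real.pi * κ ^ 2 := by
    refine le_trans ?_ (integral_discPoisson_mul_norm_sq_le hR hf him hz)
    have h1 := hper.intervalIntegral_add_eq 0 (θ₀ - Real.pi)
    rw [zero_add] at h1
    rw [h1, intervalIntegral.integral_of_le (by linarith [Real.pi_pos])]
    refine setIntegral_mono_set ?_ ?_ (angleArc_subset ht1).eventuallyLE
    · exact (hGc.integrableOn_Icc (a := θ₀ - Real.pi)
        (b := θ₀ - Real.pi + 2 * Real.pi)).mono_set Ioc_subset_Icc_self
    · filter_upwards with θ using mul_nonneg (discPoisson_nonneg hz θ) (by positivity)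
  refine (meanOsc_le_two_mul ht (hint hfc) (f z)).trans ?_
  have hle : ∫ θ in angleArc θ₀ t, ‖f (circlePt θ) - f z‖ ≤
      ∫ θ in angleArc θ₀ t, (κ / 2 + 25 * t / (2 * κ) *
        (discPoisson z θ * ‖f (circlePt θ) - f z‖ ^ 2)) := by
    refine setIntegral_mono_on (hint (hfc.sub continuous_const).norm)
      (hint (continuous_const.add (continuous_const.mul hGc))) measurableSet_Ioo fun θ hθ => ?_
    have h1 := one_le_discPoisson_of_mem_angleArc ht ht1 hθ
    rw [← hzdef] at h1
    set x := ‖f (circlePt θ) - f z‖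
    have h2 : x ^ 2 ≤ 25 * t * discPoisson z θ * x ^ 2 := le_mul_of_one_le_left (sq_nonneg x) h1
    have h3 : x ≤ κ / 2 + 1 / (2 * κ) * x ^ 2 := by
      have : 0 ≤ (x - κ) ^ 2 / (2 * κ) := by positivity
      have h4 : (x - κ) ^ 2 / (2 * κ) = κ / 2 + 1 / (2 * κ) * x ^ 2 - x := by field_simp; ring
      linarith
    calc x ≤ κ / 2 + 1 / (2 * κ) * x ^ 2 := h3
      _ ≤ κ / 2 + 1 / (2 * κ) * (25 * t * discPoisson z θ * x ^ 2) := by gcongr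
      _ = _ := by ring
  have hpos : 0 < 2 * Real.pi * t := by positivity
  calc _ ≤ 2 * ((2 * Real.pi * t)⁻¹ * (2 * Real.pi * t * (κ / 2) +
        25 * t / (2 * κ) * (16 * Real.pi * κ ^ 2))) := by
        gcongr
        refine hle.trans ?_
        have i1 : IntegrableOn (fun _ => κ / 2) (angleArc θ₀ t) := hint continuous_const
        have i2 : IntegrableOn (fun θ => 25 * t / (2 * κ) *
            (discPoisson z θ * ‖f (circlePt θ) - f z‖ ^ 2)) (angleArc θ₀ t) :=
          hint (continuous_const.mul hGc)
        rw [integral_add i1 i2, setIntegral_const, volume_real_angleArc θ₀ ht, smul_eq_mul, integral_const_mul]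
        gcongr
    _ = 201 * κ := by field_simp; ring

end Garsia

theorem norm_circlePt_sub_ofReal_sq (r s : ℝ) :
    ‖circlePt s - (r : ℂ)‖ ^ 2 = 1 - 2 * r * Real.cos s + r ^ 2 := by
  rw [← Complex.normSq_eq_norm_sq, Complex.normSq_apply]
  simp only [circlePt, Complex.sub_re, Complex.sub_im, Complex.exp_ofReal_mul_I_re,
    Complex.exp_ofReal_mul_I_im, Complex.ofReal_re, Complex.ofReal_im]
  nlinarith [Real.sin_sq_add_cos_sq s]

theorem discPoisson_ofReal {r : ℝ} (s : ℝ) :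
    discPoisson (r : ℂ) s = (1 - r ^ 2) / (1 - 2 * r * Real.cos s + r ^ 2) := by
  rw [discPoisson, norm_circlePt_sub_ofReal_sq, Complex.norm_real, Real.norm_eq_abs, sq_abs]

theorem discPoisson_mul_circlePt (r θ s : ℝ) :
    discPoisson ((r : ℂ) * circlePt θ) (θ + s) = discPoisson (r : ℂ) s := by
  have h : circlePt (θ + s) - (r : ℂ) * circlePt θ = circlePt θ * (circlePt s - r) := by
    simp only [circlePt, mul_sub, ← Complex.exp_add]
    push_cast
    ring_nf
  simp only [discPoisson, h, norm_mul, norm_circlePt, one_mul, mul_one]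

section ApproximateIdentity

variable {r : ℝ}

theorem poissonDenom_pos (hr0 : 0 ≤ r) (hr1 : r < 1) (s : ℝ) :
    0 < 1 - 2 * r * Real.cos s + r ^ 2 := by
  nlinarith [mul_nonneg hr0 (sub_nonneg.2 (Real.cos_le_one s)), mul_pos (sub_pos.2 hr1) (sub_pos.2 hr1)]

/-- The derivative of the Poisson kernel in the angle variable. -/
def discPoissonDeriv (r s : ℝ) : ℝ :=
  -((1 - r ^ 2) * (2 * r * Real.sin s)) / (1 - 2 * r * Real.cos s + r ^ 2) ^ 2

theorem hasDerivAt_discPoisson_ofReal (hr0 : 0 ≤ r) (hr1 : r < 1) (s : ℝ) :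
    HasDerivAt (discPoisson (r : ℂ)) (discPoissonDeriv r s) s := by
  have h1 : HasDerivAt (fun s => 1 - 2 * r * Real.cos s + r ^ 2) (2 * r * Real.sin s) s := by
    simpa using (((Real.hasDerivAt_cos s).const_mul (2 * r)).const_sub 1).add_const (r ^ 2)
  have h2 := (hasDerivAt_const s (1 - r ^ 2)).div h1 (poissonDenom_pos hr0 hr1 s).ne'
  have h3 : discPoisson (r : ℂ) = fun s => (1 - r ^ 2) / (1 - 2 * r * Real.cos s + r ^ 2) :=
    funext fun s => discPoisson_ofReal s
  rw [h3]
  rw [zero_mul, zero_sub] at h2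
  exact h2

theorem continuous_discPoissonDeriv (hr0 : 0 ≤ r) (hr1 : r < 1) :
    Continuous (discPoissonDeriv r) := by
  unfold discPoissonDeriv
  exact Continuous.div (by fun_prop) (by fun_prop)
    fun s => pow_ne_zero 2 (poissonDenom_pos hr0 hr1 s).ne'

theorem norm_ofReal_lt_one (hr0 : 0 ≤ r) (hr1 : r < 1) : ‖(r : ℂ)‖ < 1 := by
  rwa [Complex.norm_real, Real.norm_of_nonneg hr0]

theorem discPoisson_ofReal_pi_le (hr0 : 0 ≤ r) (hr1 : r < 1) :
    discPoisson (r : ℂ) Real.pi ≤ 1 - r := by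
  rw [discPoisson_ofReal, Real.cos_pi, div_le_iff₀ (by nlinarith)]
  nlinarith [mul_nonneg hr0 (sub_nonneg.2 hr1.le), mul_nonneg (mul_nonneg hr0 hr0) (sub_nonneg.2 hr1.le)]

theorem discPoisson_ofReal_neg (s : ℝ) : discPoisson (r : ℂ) (-s) = discPoisson (r : ℂ) s := by
  simp only [discPoisson_ofReal, Real.cos_neg]

theorem integral_neg_mul_discPoissonDeriv_le (hr0 : 0 ≤ r) (hr1 : r < 1) :
    ∫ s in -Real.pi..Real.pi, -(s * discPoissonDeriv r s) ≤ 2 * Real.pi := by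
  have hz := norm_ofReal_lt_one hr0 hr1
  have h := intervalIntegral.integral_mul_deriv_eq_deriv_mul (a := -Real.pi) (b := Real.pi)
    (u := fun s => s) (v := discPoisson (r : ℂ)) (u' := fun _ => 1) (v' := discPoissonDeriv r)
    (fun s _ => hasDerivAt_id s) (fun s _ => hasDerivAt_discPoisson_ofReal hr0 hr1 s)
    (continuous_const.intervalIntegrable _ _)
    ((continuous_discPoissonDeriv hr0 hr1).intervalIntegrable _ _)
  have hper := (discPoisson_periodic (r : ℂ)).intervalIntegral_add_eq 0 (-Real.pi)
  rw [zero_add, show -Real.pi + 2 * Real.pi = Real.pi by ring, integral_discPoisson hz] at hper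
  rw [intervalIntegral.integral_neg, h]
  simp only [one_mul, discPoisson_ofReal_neg, ← hper]
  nlinarith [mul_nonneg Real.pi_pos.le (discPoisson_nonneg hz Real.pi)]

theorem abs_discPoissonDeriv_le (hr0 : 1 / 2 ≤ r) (hr1 : r < 1) {δ s : ℝ} (hδ : 0 < δ)
    (hδs : δ ≤ |s|) (hs : |s| ≤ Real.pi) :
    |discPoissonDeriv r s| ≤ 4 * (1 - r) / (1 - Real.cos δ) ^ 2 := by
  have hcos : Real.cos s ≤ Real.cos δ := by
    rw [← Real.cos_abs s]; exact Real.cos_le_cos_of_nonneg_of_le_pi hδ.le hs hδs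
  have hc : 0 < 1 - Real.cos δ := by
    have := Real.cos_lt_cos_of_nonneg_of_le_pi le_rfl (hδs.trans hs) hδ
    rw [Real.cos_zero] at this; linarith
  have hD : 1 - Real.cos δ ≤ 1 - 2 * r * Real.cos s + r ^ 2 := by
    nlinarith [mul_nonneg (by linarith : 0 ≤ 2 * r - 1) (sub_nonneg.2 (Real.cos_le_one s)),
      sq_nonneg (1 - r)]
  have hsin := Real.abs_sin_le_one s
  rw [discPoissonDeriv, abs_div, abs_neg, abs_mul, abs_mul,
    abs_of_nonneg (by nlinarith : 0 ≤ 1 - r ^ 2), abs_of_nonneg (by linarith : 0 ≤ 2 * r),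
    abs_pow, sq_abs]
  have h1 : 1 - r ^ 2 ≤ 2 * (1 - r) := by nlinarith
  have h2 : 2 * r * |Real.sin s| ≤ 2 := by nlinarith [abs_nonneg (Real.sin s)]
  have h3 : (1 - r ^ 2) * (2 * r * |Real.sin s|) ≤ 4 * (1 - r) := by
    calc _ ≤ 2 * (1 - r) * 2 := mul_le_mul h1 h2 (by positivity) (by linarith)
      _ = _ := by ring
  exact div_le_div₀ (by linarith) h3 (by positivity) (pow_le_pow_left₀ hc.le hD 2)

theorem abs_discPoissonDeriv_mul_abs (hr0 : 0 ≤ r) (hr1 : r < 1) {s : ℝ} (hs : |s| ≤ Real.pi) :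
    |discPoissonDeriv r s| * |s| = -(s * discPoissonDeriv r s) := by
  rw [mul_comm, ← abs_mul, abs_of_nonpos]
  have h : 0 ≤ s * Real.sin s := by
    rcases le_total 0 s with h | h
    · exact mul_nonneg h (Real.sin_nonneg_of_nonneg_of_le_pi h ((le_abs_self s).trans hs))
    · exact mul_nonneg_of_nonpos_of_nonpos h
        (Real.sin_nonpos_of_nonpos_of_neg_pi_le h (by linarith [(abs_le.1 hs).1]))
  have : s * discPoissonDeriv r s = -((1 - r ^ 2) * (2 * r) * (s * Real.sin s) /
      (1 - 2 * r * Real.cos s + r ^ 2) ^ 2) := by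
    rw [discPoissonDeriv]; ring
  rw [this, neg_nonpos]
  have : 0 ≤ 1 - r ^ 2 := by nlinarith
  positivity

end ApproximateIdentity

theorem tendsto_integral_discPoisson_mul_zero {g : ℝ → ℝ}
    (hg : IntervalIntegrable g volume (-Real.pi) Real.pi)
    (h0 : HasDerivAt (fun x => ∫ t in (0 : ℝ)..x, g t) 0 0) :
    Tendsto (fun r : ℝ => ∫ s in -Real.pi..Real.pi, discPoisson (r : ℂ) s * g s)
      (𝓝[<] 1) (𝓝 0) := by
  set Φ : ℝ → ℝ := fun x => ∫ t in (0 : ℝ)..x, g t with hΦ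
  have hpi := Real.pi_pos
  have hmem0 : (0 : ℝ) ∈ uIcc (-Real.pi) Real.pi := by
    rw [uIcc_of_le (by linarith)]; constructor <;> linarith
  have hac : AbsolutelyContinuousOnInterval Φ (-Real.pi) Real.pi :=
    hg.absolutelyContinuousOnInterval_intervalIntegral hmem0
  obtain ⟨M, hM⟩ := hac.exists_bound
  have hM0 : 0 ≤ M := (norm_nonneg _).trans (hM 0 hmem0)
  have hder : ∀ᵐ x, x ∈ uIcc (-Real.pi) Real.pi → deriv Φ x = g x := by
    filter_upwards [hg.ae_hasDerivAt_integral] with x hx hmem using (hx hmem 0 hmem0).deriv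
  rw [Metric.tendsto_nhds]
  intro ε' hε'
  set ε := ε' / (2 * Real.pi + 2) with hε
  have hε0 : 0 < ε := by positivity
  obtain ⟨δ, hδ, hsmall⟩ : ∃ δ > 0, ∀ s, |s| < δ → |Φ s| ≤ ε * |s| := by
    have := h0.isLittleO.def hε0
    rw [Metric.eventually_nhds_iff] at this
    obtain ⟨δ, hδ, h⟩ := this
    refine ⟨δ, hδ, fun s hs => ?_⟩
    have h2 := h (y := s) (by simpa using hs)
    simpa [hΦ] using h2
  set K := 2 * M + 2 * Real.pi * (4 / (1 - Real.cos δ) ^ 2 * M) with hK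
  have hK0 : 0 ≤ K := by positivity
  have hlim : ∀ᶠ r in 𝓝[<] (1 : ℝ), K * (1 - r) < ε := by
    have : Tendsto (fun r : ℝ => K * (1 - r)) (𝓝[<] 1) (𝓝 (K * (1 - 1))) :=
      ((continuous_const.mul (continuous_const.sub continuous_id)).tendsto 1).mono_left
        nhdsWithin_le_nhds
    rw [sub_self, mul_zero] at this
    exact this.eventually_lt_const hε0
  filter_upwards [hlim, Ioo_mem_nhdsLT (show (1 / 2 : ℝ) < 1 by norm_num)] with r hr hrmem
  obtain ⟨hr2, hr1⟩ := hrmem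
  have hr0 : 0 ≤ r := by linarith
  have hz := norm_ofReal_lt_one hr0 hr1
  have hpc : ContDiff ℝ 1 (discPoisson (r : ℂ)) := by
    refine contDiff_one_iff_deriv.2 ⟨fun s => (hasDerivAt_discPoisson_ofReal hr0 hr1 s).differentiableAt, ?_⟩
    rw [show deriv (discPoisson (r : ℂ)) = discPoissonDeriv r from
      funext fun s => (hasDerivAt_discPoisson_ofReal hr0 hr1 s).deriv]
    exact continuous_discPoissonDeriv hr0 hr1
  have hibp := (hpc.contDiffOn (s := uIcc (-Real.pi) Real.pi)).absolutelyContinuousOnInterval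
    |>.integral_mul_deriv_eq_deriv_mul hac
  have hcongr : ∫ s in -Real.pi..Real.pi, discPoisson (r : ℂ) s * g s =
      ∫ s in -Real.pi..Real.pi, discPoisson (r : ℂ) s * deriv Φ s := by
    refine intervalIntegral.integral_congr_ae ?_
    filter_upwards [hder] with x hx hmem
    rw [hx (uIoc_subset_uIcc hmem)]
  have hrem : |∫ s in -Real.pi..Real.pi, deriv (discPoisson (r : ℂ)) s * Φ s| ≤
      ε * (2 * Real.pi) + 2 * Real.pi * (4 * (1 - r) / (1 - Real.cos δ) ^ 2 * M) := by
    have hdc : Continuous fun s => -(s * discPoissonDeriv r s) :=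
      (continuous_id.mul (continuous_discPoissonDeriv hr0 hr1)).neg
    have hb : ∀ s ∈ Ioc (-Real.pi) Real.pi, ‖deriv (discPoisson (r : ℂ)) s * Φ s‖ ≤
        ε * (-(s * discPoissonDeriv r s)) + 4 * (1 - r) / (1 - Real.cos δ) ^ 2 * M := by
      intro s hs
      have hsabs : |s| ≤ Real.pi := abs_le.2 ⟨hs.1.le, hs.2⟩
      have hnn := abs_discPoissonDeriv_mul_abs hr0 hr1 hsabs
      have h1r : 0 ≤ 1 - r := by linarith
      rw [(hasDerivAt_discPoisson_ofReal hr0 hr1 s).deriv, norm_mul, Real.norm_eq_abs, Real.norm_eq_abs]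
      rcases lt_or_ge |s| δ with h | h
      · have h1 : |discPoissonDeriv r s| * |Φ s| ≤ |discPoissonDeriv r s| * (ε * |s|) := by
          gcongr; exact hsmall s h
        have h2 : 0 ≤ 4 * (1 - r) / (1 - Real.cos δ) ^ 2 * M := by positivity
        rw [← hnn]; linarith
      · have h1 := abs_discPoissonDeriv_le hr2.le hr1 hδ h hsabs
        have h2 : |Φ s| ≤ M := hM s (by
          rw [uIcc_of_le (by linarith)]; exact Ioc_subset_Icc_self hs)
        have h3 : 0 ≤ ε * (-(s * discPoissonDeriv r s)) := by rw [← hnn]; positivity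
        have h4 : |discPoissonDeriv r s| * |Φ s| ≤ 4 * (1 - r) / (1 - Real.cos δ) ^ 2 * M := by
          gcongr
        linarith
    have h1 := intervalIntegral.norm_integral_le_of_norm_le (μ := volume) (by linarith)
      (Eventually.of_forall hb)
      (((continuous_const.mul hdc).add continuous_const).intervalIntegrable _ _)
    refine h1.trans ?_
    have i1 : IntervalIntegrable (fun s => ε * -(s * discPoissonDeriv r s)) volume
        (-Real.pi) Real.pi := (continuous_const.mul hdc).intervalIntegrable _ _
    rw [intervalIntegral.integral_add i1 (continuous_const.intervalIntegrable _ _), intervalIntegral.integral_const_mul,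
      intervalIntegral.integral_const, smul_eq_mul, show Real.pi - -Real.pi = 2 * Real.pi by ring]
    gcongr
    exact integral_neg_mul_discPoissonDeriv_le hr0 hr1
  have hp := discPoisson_ofReal_pi_le hr0 hr1
  have hp0 := discPoisson_nonneg hz Real.pi
  have hb1 : |discPoisson (r : ℂ) Real.pi * Φ Real.pi| ≤ (1 - r) * M := by
    rw [abs_mul, abs_of_nonneg hp0]
    exact mul_le_mul hp (hM _ right_mem_uIcc) (abs_nonneg _) (by linarith)
  have hb2 : |discPoisson (r : ℂ) Real.pi * Φ (-Real.pi)| ≤ (1 - r) * M := by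
    rw [abs_mul, abs_of_nonneg hp0]
    exact mul_le_mul hp (hM _ left_mem_uIcc) (abs_nonneg _) (by linarith)
  rw [Real.dist_eq, sub_zero, hcongr, hibp, discPoisson_ofReal_neg]
  have hfin : ε * (2 * Real.pi + 2) = ε' := by rw [hε]; field_simp
  have hKe : K * (1 - r) = 2 * ((1 - r) * M) +
      2 * Real.pi * (4 * (1 - r) / (1 - Real.cos δ) ^ 2 * M) := by rw [hK]; ring
  refine ((abs_sub _ _).trans (add_le_add_left (abs_sub _ _) _)).trans_lt ?_
  linarith

/-- Fatou's theorem for the Poisson integral of a real function. -/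
theorem ae_tendsto_integral_discPoisson_mul {f : ℝ → ℝ} (hper : Function.Periodic f (2 * Real.pi))
    (hf : IntervalIntegrable f volume 0 (2 * Real.pi)) :
    ∀ᵐ θ₀, Tendsto (fun r : ℝ => ∫ θ in (0 : ℝ)..2 * Real.pi,
      discPoisson ((r : ℂ) * circlePt θ₀) θ * f θ) (𝓝[<] 1) (𝓝 (2 * Real.pi * f θ₀)) := by
  have hint : ∀ a b, IntervalIntegrable f volume a b := hper.intervalIntegrable₀ (by positivity) hf
  have hloc : LocallyIntegrable f volume := by
    refine fun x => ⟨Ioo (x - 1) (x + 1), Ioo_mem_nhds (by linarith) (by linarith), ?_⟩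
    exact (hint (x - 1) (x + 1)).1.mono_set Ioo_subset_Ioc_self
  filter_upwards [LocallyIntegrable.ae_hasDerivAt_integral hloc] with θ₀ hθ₀
  have hint' : ∀ a b, IntervalIntegrable (fun s => f (θ₀ + s)) volume a b := fun a b => by
    simpa using (hint (θ₀ + a) (θ₀ + b)).comp_add_left θ₀
  have hg : IntervalIntegrable (fun s => f (θ₀ + s) - f θ₀) volume (-Real.pi) Real.pi :=
    (hint' _ _).sub intervalIntegrable_const
  have h0 : HasDerivAt (fun x => ∫ t in (0 : ℝ)..x, (f (θ₀ + t) - f θ₀)) 0 0 := by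
    have h1 : HasDerivAt (fun x => ∫ t in θ₀..(θ₀ + x), f t) (f θ₀) 0 := by
      have := hθ₀ θ₀
      rw [← add_zero θ₀] at this
      simpa using HasDerivAt.comp_const_add θ₀ 0 this
    have h2 := h1.sub ((hasDerivAt_id (0 : ℝ)).mul_const (f θ₀))
    rw [one_mul, sub_self] at h2
    refine h2.congr_of_eventuallyEq (Eventually.of_forall fun x => ?_)
    simp only [Pi.sub_apply, id]
    rw [intervalIntegral.integral_sub (hint' _ _) intervalIntegrable_const,
      intervalIntegral.integral_comp_add_left (fun t => f t), intervalIntegral.integral_const]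
    simp
  have h := (tendsto_integral_discPoisson_mul_zero hg h0).add_const (2 * Real.pi * f θ₀)
  rw [zero_add] at h
  refine h.congr' ?_
  filter_upwards [Ioo_mem_nhdsLT (show (0 : ℝ) < 1 by norm_num)] with r hr
  have hz := norm_ofReal_lt_one hr.1.le hr.2
  have hpc := continuous_discPoisson hz
  have hp1 : Function.Periodic (fun θ => discPoisson ((r : ℂ) * circlePt θ₀) θ * f θ)
      (2 * Real.pi) := (discPoisson_periodic _).mul hper
  have hp2 := hp1.intervalIntegral_add_eq 0 (θ₀ - Real.pi)
  rw [zero_add] at hp2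
  have h3 := intervalIntegral.integral_comp_add_left (a := -Real.pi) (b := Real.pi)
    (fun θ => discPoisson ((r : ℂ) * circlePt θ₀) θ * f θ) θ₀
  rw [hp2, show θ₀ - Real.pi = θ₀ + -Real.pi by ring,
    show θ₀ + -Real.pi + 2 * Real.pi = θ₀ + Real.pi by ring, ← h3]
  simp only [discPoisson_mul_circlePt, mul_sub]
  have hpd := (discPoisson_periodic (r : ℂ)).intervalIntegral_add_eq 0 (-Real.pi)
  rw [zero_add, show -Real.pi + 2 * Real.pi = Real.pi by ring, integral_discPoisson hz] at hpd
  rw [intervalIntegral.integral_sub, intervalIntegral.integral_mul_const, ← hpd, sub_add_cancel]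
  · exact (hint' _ _).continuousOn_mul hpc.continuousOn
  · exact (hpc.mul continuous_const).intervalIntegrable _ _

/-- Fatou's theorem for the Poisson integral of a complex function. -/
theorem ae_tendsto_integral_discPoisson_mul_complex {f : ℝ → ℂ}
    (hper : Function.Periodic f (2 * Real.pi))
    (hf : IntervalIntegrable f volume 0 (2 * Real.pi)) :
    ∀ᵐ θ₀, Tendsto (fun r : ℝ => ∫ θ in (0 : ℝ)..2 * Real.pi,
      (discPoisson ((r : ℂ) * circlePt θ₀) θ : ℂ) * f θ) (𝓝[<] 1) (𝓝 (2 * Real.pi * f θ₀)) := by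
  have hre := ae_tendsto_integral_discPoisson_mul (f := fun θ => (f θ).re)
    (fun θ => by simp only [hper θ]) ⟨hf.1.re, hf.2.re⟩
  have him := ae_tendsto_integral_discPoisson_mul (f := fun θ => (f θ).im)
    (fun θ => by simp only [hper θ]) ⟨hf.1.im, hf.2.im⟩
  filter_upwards [hre, him] with θ₀ h1 h2
  have h := ((Complex.continuous_ofReal.tendsto _).comp h1).add
    (((Complex.continuous_ofReal.tendsto _).comp h2).mul_const Complex.I)
  have e : ((2 * Real.pi * (f θ₀).re : ℝ) : ℂ) + ((2 * Real.pi * (f θ₀).im : ℝ) : ℂ) * Complex.I =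
      2 * Real.pi * f θ₀ := by
    conv_rhs => rw [← Complex.re_add_im (f θ₀)]
    push_cast; ring
  rw [e] at h
  refine h.congr' ?_
  filter_upwards [Ioo_mem_nhdsLT (show (0 : ℝ) < 1 by norm_num)] with r hr
  have hz : ‖(r : ℂ) * circlePt θ₀‖ < 1 := by
    rw [norm_mul, norm_circlePt, mul_one]; exact norm_ofReal_lt_one hr.1.le hr.2
  have hi : IntervalIntegrable (fun θ => (discPoisson ((r : ℂ) * circlePt θ₀) θ : ℂ) * f θ) volume
      0 (2 * Real.pi) := hf.continuousOn_mul
    (Complex.continuous_ofReal.comp (continuous_discPoisson hz)).continuousOn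
  rw [intervalIntegrable_iff] at hi
  have := integral_re_add_im hi
  simp only [intervalIntegral.integral_of_le Real.two_pi_pos.le, Function.comp_apply] at *
  rw [uIoc_of_le Real.two_pi_pos.le] at this
  rw [← this]
  simp

theorem re_one_add_div_one_sub (u : ℂ) :
    ((1 + u) / (1 - u)).re = (1 - ‖u‖ ^ 2) / ‖1 - u‖ ^ 2 := by
  rw [Complex.div_re, ← Complex.normSq_eq_norm_sq, ← Complex.normSq_eq_norm_sq, ← add_div,
    Complex.normSq_apply u]
  congr 1
  simp only [Complex.add_re, Complex.sub_re, Complex.one_re, Complex.add_im, Complex.sub_im,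
    Complex.one_im]
  ring

/-- The kernel `(1 + conj w * z) / (1 - conj w * z)`. -/
def polarHerglotz (z w : ℂ) : ℂ :=
  (1 + (starRingEnd ℂ) w * z) / (1 - (starRingEnd ℂ) w * z)

theorem norm_conj_mul_le {z w : ℂ} : ‖(starRingEnd ℂ) w * z‖ = ‖w‖ * ‖z‖ := by
  rw [norm_mul, RCLike.norm_conj]

theorem one_sub_le_norm_one_sub_conj_mul {z w : ℂ} {c : ℝ} (h : ‖w‖ * ‖z‖ ≤ c) :
    1 - c ≤ ‖1 - (starRingEnd ℂ) w * z‖ := by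
  have := norm_sub_norm_le (1 : ℂ) ((starRingEnd ℂ) w * z)
  rw [norm_one, norm_conj_mul_le] at this
  linarith

theorem re_polarHerglotz_nonneg {z w : ℂ} (h : ‖w‖ * ‖z‖ ≤ 1) : 0 ≤ (polarHerglotz z w).re := by
  rw [polarHerglotz, re_one_add_div_one_sub, norm_conj_mul_le]
  have : (‖w‖ * ‖z‖) ^ 2 ≤ 1 := pow_le_one₀ (by positivity) h
  have : 0 ≤ 1 - (‖w‖ * ‖z‖) ^ 2 := by linarith
  positivity

theorem norm_polarHerglotz_le {z w : ℂ} {c : ℝ} (hc : c < 1) (h : ‖w‖ * ‖z‖ ≤ c) :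
    ‖polarHerglotz z w‖ ≤ 2 / (1 - c) := by
  rw [polarHerglotz, norm_div]
  refine div_le_div₀ zero_le_two ?_ (by linarith) (one_sub_le_norm_one_sub_conj_mul h)
  refine (norm_add_le _ _).trans ?_
  rw [norm_one, norm_conj_mul_le]
  linarith

@[fun_prop]
theorem measurable_polarHerglotz (z : ℂ) : Measurable (polarHerglotz z) := by
  unfold polarHerglotz
  fun_prop

theorem re_polarHerglotz_circlePt (w : ℂ) (θ : ℝ) :
    (polarHerglotz (circlePt θ) w).re = discPoisson w θ := by
  have h : ‖1 - (starRingEnd ℂ) w * circlePt θ‖ = ‖circlePt θ - w‖ := by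
    have h1 : (starRingEnd ℂ) (circlePt θ) * circlePt θ = 1 := by
      rw [mul_comm, Complex.mul_conj, Complex.normSq_eq_norm_sq, norm_circlePt]; simp
    rw [← h1, ← sub_mul, norm_mul, norm_circlePt, mul_one, ← map_sub, RCLike.norm_conj]
  rw [polarHerglotz, re_one_add_div_one_sub, norm_conj_mul_le, norm_circlePt, mul_one, h,
    discPoisson]

theorem hasDerivAt_polarHerglotz {z w : ℂ} (h : 1 - (starRingEnd ℂ) w * z ≠ 0) :
    HasDerivAt (fun z => polarHerglotz z w)
      (2 * (starRingEnd ℂ) w / (1 - (starRingEnd ℂ) w * z) ^ 2) z := by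
  have h1 : HasDerivAt (fun z => 1 + (starRingEnd ℂ) w * z) ((starRingEnd ℂ) w) z := by
    simpa using ((hasDerivAt_id z).const_mul ((starRingEnd ℂ) w)).const_add 1
  have h2 : HasDerivAt (fun z => 1 - (starRingEnd ℂ) w * z) (-(starRingEnd ℂ) w) z := by
    simpa using ((hasDerivAt_id z).const_mul ((starRingEnd ℂ) w)).const_sub 1
  refine (h1.div h2 h).congr_deriv ?_
  ring

theorem integral_discPoisson_mul_discPoisson {z w : ℂ} (hz : ‖z‖ < 1) (hw : ‖w‖ < 1) :
    ∫ θ in (0 : ℝ)..2 * Real.pi, discPoisson z θ * discPoisson w θ =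
      2 * Real.pi * (polarHerglotz z w).re := by
  have hR : 1 < 2 / (1 + ‖w‖) := by
    rw [lt_div_iff₀ (by positivity)]; linarith
  have hd : DifferentiableOn ℂ (fun z => polarHerglotz z w) (Metric.ball 0 (2 / (1 + ‖w‖))) := by
    intro ξ hξ
    rw [mem_ball_zero_iff, lt_div_iff₀ (by positivity)] at hξ
    refine (hasDerivAt_polarHerglotz ?_).differentiableAt.differentiableWithinAt
    have h1 : ‖w‖ * ‖ξ‖ < 1 := by
      by_contra! h
      have h2 := norm_nonneg ξ
      have h3 := norm_nonneg w
      nlinarith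
    have h2 := one_sub_le_norm_one_sub_conj_mul (z := ξ) (w := w) le_rfl
    exact norm_pos_iff.1 (by linarith)
  have h := congrArg Complex.re (integral_discPoisson_smul hR hd hz)
  have hc := continuous_comp_circlePt hR hd
  have hi : IntervalIntegrable (fun θ => (discPoisson z θ : ℂ) * polarHerglotz (circlePt θ) w)
      volume 0 (2 * Real.pi) :=
    ((Complex.continuous_ofReal.comp (continuous_discPoisson hz)).mul hc).intervalIntegrable _ _
  have h2 := Complex.reCLM.intervalIntegral_comp_comm hi
  simp only [Complex.reCLM_apply, Complex.re_ofReal_mul, re_polarHerglotz_circlePt] at h2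
  rw [h2, h, ← Complex.ofReal_ofNat, ← Complex.ofReal_mul, Complex.re_ofReal_mul]

@[fun_prop]
theorem measurable_discPoisson : Measurable fun p : ℂ × ℝ => discPoisson p.1 p.2 := by
  unfold discPoisson
  have := continuous_circlePt.measurable
  fun_prop

theorem discPoisson_le {z : ℂ} {ρ : ℝ} (hρ : ρ < 1) (hz : ‖z‖ ≤ ρ) (θ : ℝ) :
    discPoisson z θ ≤ 1 / (1 - ρ) ^ 2 := by
  have h := norm_sub_norm_le (circlePt θ) z
  rw [norm_circlePt] at h
  have h2 : 0 < 1 - ρ := by linarith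
  refine div_le_div₀ zero_le_one ?_ (by positivity) (pow_le_pow_left₀ h2.le (by linarith) 2)
  nlinarith [sq_nonneg ‖z‖]

theorem half_le_integral_discPoisson {θ₀ t : ℝ} {z : ℂ} (hz : z ∈ carlesonSquare θ₀ t) :
    1 / 2 ≤ ∫ θ in Icc (θ₀ - (Real.pi + 1) * t) (θ₀ + (Real.pi + 1) * t), discPoisson z θ := by
  obtain ⟨hz1, hzt, α, hα, hzα⟩ := hz
  have hz1 : ‖z‖ < 1 := hz1
  set s := 1 - ‖z‖ with hs
  have hs0 : 0 < s := by linarith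
  obtain ⟨hα1, hα2⟩ := abs_le.1 hα
  have hsub : Icc (α - s) (α + s) ⊆ Icc (θ₀ - (Real.pi + 1) * t) (θ₀ + (Real.pi + 1) * t) :=
    Icc_subset_Icc (by linarith) (by linarith)
  have hint : IntegrableOn (discPoisson z)
      (Icc (θ₀ - (Real.pi + 1) * t) (θ₀ + (Real.pi + 1) * t)) :=
    (continuous_discPoisson hz1).integrableOn_Icc
  have hle : ∀ θ ∈ Icc (α - s) (α + s), 1 / (4 * s) ≤ discPoisson z θ := by
    intro θ hθ
    have h1 : ‖circlePt θ - z‖ ≤ 2 * s := by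
      have h2 : circlePt θ - z = (circlePt θ - circlePt α) + (s : ℂ) * circlePt α := by
        conv_lhs => rw [hzα]
        rw [hs]; push_cast; ring
      rw [h2]
      refine (norm_add_le _ _).trans ?_
      rw [norm_mul, norm_circlePt, mul_one, Complex.norm_real, Real.norm_of_nonneg hs0.le]
      have := (norm_circlePt_sub_le θ α).trans
        (abs_le.2 ⟨by linarith [hθ.1], by linarith [hθ.2]⟩ : |θ - α| ≤ s)
      linarith
    have h3 : 0 < ‖circlePt θ - z‖ := norm_pos_iff.2 (circlePt_sub_ne_zero hz1 θ)
    have h4 := pow_le_pow_left₀ h3.le h1 2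
    rw [discPoisson, div_le_div_iff₀ (by positivity) (by positivity)]
    have h5 : 1 - ‖z‖ ^ 2 = s * (1 + ‖z‖) := by rw [hs]; ring
    rw [h5]
    nlinarith [mul_nonneg (sq_nonneg s) (norm_nonneg z)]
  calc (1 : ℝ) / 2 = ∫ _ in Icc (α - s) (α + s), 1 / (4 * s) := by
        rw [setIntegral_const, Real.volume_real_Icc_of_le (by linarith), smul_eq_mul]
        field_simp; ring
    _ ≤ ∫ θ in Icc (α - s) (α + s), discPoisson z θ :=
        setIntegral_mono_on continuous_const.integrableOn_Icc (hint.mono_set hsub)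
          measurableSet_Icc hle
    _ ≤ _ := setIntegral_mono_set hint
        (Eventually.of_forall fun θ => discPoisson_nonneg hz1 θ) hsub.eventuallyLE

section Energy

variable {σ : Measure ℂ} [IsFiniteMeasure σ] {ρ : ℝ}

theorem integral_discPoisson_swap (hρ : ρ < 1) (hσ : ∀ᵐ z ∂σ, ‖z‖ ≤ ρ) {τ : Measure ℝ}
    [IsFiniteMeasure τ] {h : ℝ → ℝ} (hh : Measurable h) {M : ℝ} (hM : ∀ θ, |h θ| ≤ M) :
    ∫ z, ∫ θ, discPoisson z θ * h θ ∂τ ∂σ = ∫ θ, (∫ z, discPoisson z θ ∂σ) * h θ ∂τ := by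
  rw [integral_integral_swap]
  · simp only [integral_mul_const]
  · refine Integrable.of_bound
      (measurable_discPoisson.mul (hh.comp measurable_snd)).aestronglyMeasurable
      (1 / (1 - ρ) ^ 2 * M) ?_
    filter_upwards [Measure.quasiMeasurePreserving_fst.ae hσ] with p hp
    rw [Function.uncurry_def, norm_mul, Real.norm_of_nonneg (discPoisson_nonneg (hp.trans_lt hρ) _)]
    exact mul_le_mul (discPoisson_le hρ hp _) (hM _) (norm_nonneg _) (by positivity)

end Energy

/-- A part of a Carleson square on which the potential of `ν` is small has small measure. -/
theorem measureReal_le_of_potential_le {ν : Measure ℂ} [IsFiniteMeasure ν] {ρ : ℝ} (hρ : ρ < 1)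
    (hν : ∀ᵐ z ∂ν, ‖z‖ ≤ ρ) {θ₀ t ε : ℝ} (hε : 0 ≤ ε) (ht : 0 < t) (ht1 : t ≤ 1 / 2) {A : Set ℂ}
    (hA : MeasurableSet A) (hAt : A ⊆ carlesonSquare θ₀ t)
    (hAε : ∀ z ∈ A, ∫ w, (polarHerglotz z w).re ∂ν ≤ ε) :
    ν.real A ≤ 16 * Real.pi * (Real.pi + 1) * ε * t := by
  have hpi := Real.pi_pos
  set σ := ν.restrict A with hσdef
  have hσ : ∀ᵐ z ∂σ, ‖z‖ ≤ ρ := ae_restrict_of_ae hν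
  set N := ν.real A with hN
  set τ := volume.restrict (Ioc (θ₀ - Real.pi) (θ₀ - Real.pi + 2 * Real.pi)) with hτ
  set B : ℝ → ℝ := fun θ => ∫ z, discPoisson z θ ∂σ with hB
  have hBm : Measurable B :=
    (measurable_discPoisson.stronglyMeasurable.integral_prod_left' (μ := σ)).measurable
  have hBbound : ∀ θ, |B θ| ≤ 1 / (1 - ρ) ^ 2 * σ.real univ := by
    intro θ
    rw [← Real.norm_eq_abs]
    refine norm_integral_le_of_norm_le_const ?_
    filter_upwards [hσ] with z hz
    rw [Real.norm_of_nonneg (discPoisson_nonneg (hz.trans_lt hρ) θ)]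
    exact discPoisson_le hρ hz θ
  have hA1 : ∀ z ∈ A, ‖z‖ < 1 := fun z hz => (hAt hz).1
  have hlow : ∀ w ∈ A, ∫ θ, discPoisson w θ * B θ ∂τ ≤ 2 * Real.pi * ε := by
    intro w hw
    have hw1 := hA1 w hw
    have hsw := integral_discPoisson_swap (σ := σ) (τ := τ) hρ hσ
      (continuous_discPoisson hw1).measurable (M := 1 / (1 - ‖w‖) ^ 2) fun θ => by
        rw [abs_of_nonneg (discPoisson_nonneg hw1 θ)]; exact discPoisson_le hw1 le_rfl θ
    have hcomm : ∫ θ, discPoisson w θ * B θ ∂τ = ∫ θ, B θ * discPoisson w θ ∂τ := by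
      simp only [mul_comm]
    rw [hcomm, hB, ← hsw]
    have hK : ∀ᵐ z ∂σ, ∫ θ, discPoisson z θ * discPoisson w θ ∂τ =
        2 * Real.pi * (polarHerglotz w z).re := by
      filter_upwards [hσ] with z hz
      have hz1 := hz.trans_lt hρ
      have hper := ((discPoisson_periodic w).mul (discPoisson_periodic z)).intervalIntegral_add_eq
        0 (θ₀ - Real.pi)
      rw [zero_add] at hper
      simp only [Pi.mul_apply] at hper
      rw [integral_discPoisson_mul_discPoisson hw1 hz1,
        intervalIntegral.integral_of_le (by linarith)] at hper
      rw [hper]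
      simp only [mul_comm, hτ]
    rw [integral_congr_ae hK, integral_const_mul]
    gcongr
    refine le_trans ?_ (hAε w hw)
    refine setIntegral_le_integral ?_ ?_
    · refine Integrable.of_bound
        (Complex.measurable_re.comp (measurable_polarHerglotz w)).aestronglyMeasurable
        (2 / (1 - ‖w‖)) ?_
      filter_upwards [hν] with z hz
      refine (Complex.abs_re_le_norm _).trans (norm_polarHerglotz_le hw1 ?_)
      exact mul_le_of_le_one_left (norm_nonneg _) (hz.trans hρ.le)
    · filter_upwards [hν] with z hz
      exact re_polarHerglotz_nonneg (mul_le_one₀ (hz.trans hρ.le) (norm_nonneg _) hw1.le)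
  have hBi : Integrable (fun θ => B θ * B θ) τ := by
    refine Integrable.of_bound (hBm.mul hBm).aestronglyMeasurable
      ((1 / (1 - ρ) ^ 2 * σ.real univ) * (1 / (1 - ρ) ^ 2 * σ.real univ)) ?_
    refine Eventually.of_forall fun θ => ?_
    rw [norm_mul]
    exact mul_le_mul (hBbound θ) (hBbound θ) (norm_nonneg _) ((abs_nonneg _).trans (hBbound θ))
  have hBi1 : Integrable B τ :=
    Integrable.of_bound hBm.aestronglyMeasurable _ (Eventually.of_forall hBbound)
  have hσA : ∀ᵐ w ∂σ, w ∈ A := ae_restrict_mem hA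
  have hN' : σ.real univ = N := by rw [hσdef, measureReal_restrict_apply_univ]
  have hup : ∫ θ, B θ * B θ ∂τ ≤ 2 * Real.pi * ε * N := by
    rw [← integral_discPoisson_swap (σ := σ) (τ := τ) hρ hσ hBm hBbound]
    have h1 : ∫ w, ∫ θ, discPoisson w θ * B θ ∂τ ∂σ ≤ ∫ _, 2 * Real.pi * ε ∂σ := by
      refine integral_mono_ae ?_ (integrable_const _) ?_
      · refine Integrable.of_bound (C := ∫ _, 1 / (1 - ρ) ^ 2 * (1 / (1 - ρ) ^ 2 * σ.real univ) ∂τ)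
          ((measurable_discPoisson.mul
          (hBm.comp measurable_snd)).stronglyMeasurable.integral_prod_right'
          (ν := τ)).aestronglyMeasurable ?_
        filter_upwards [hσ] with w hw
        refine norm_integral_le_of_norm_le (integrable_const _) (Eventually.of_forall fun θ => ?_)
        rw [norm_mul, Real.norm_of_nonneg (discPoisson_nonneg (hw.trans_lt hρ) θ)]
        exact mul_le_mul (discPoisson_le hρ hw θ) (hBbound θ) (norm_nonneg _) (by positivity)
      · filter_upwards [hσA] with w hw using hlow w hw
    rw [integral_const, hN', smul_eq_mul] at h1
    linarith
  set J := Icc (θ₀ - (Real.pi + 1) * t) (θ₀ + (Real.pi + 1) * t) with hJ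
  have hJsub : J ⊆ Ioc (θ₀ - Real.pi) (θ₀ - Real.pi + 2 * Real.pi) := by
    intro θ hθ
    have := Real.pi_gt_three
    have h2 : (Real.pi + 1) * t < Real.pi := by nlinarith
    exact ⟨by linarith [hθ.1], by linarith [hθ.2]⟩
  have hτJ : τ.restrict J = volume.restrict J := by
    rw [hτ, Measure.restrict_restrict measurableSet_Icc, inter_eq_left.2 hJsub]
  have hBJ : N / 2 ≤ ∫ θ in J, B θ := by
    have h1 := integral_discPoisson_swap (σ := σ) (τ := volume.restrict J) hρ hσ
      (h := fun _ => 1) measurable_const (M := 1) (fun _ => by simp)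
    simp only [mul_one] at h1
    rw [← h1]
    calc N / 2 = ∫ _, 1 / 2 ∂σ := by rw [integral_const, hN', smul_eq_mul]; ring
      _ ≤ _ := by
        refine integral_mono_ae (integrable_const _) ?_ ?_
        · refine Integrable.of_bound (C := ∫ _ in J, 1 / (1 - ρ) ^ 2)
            (measurable_discPoisson.stronglyMeasurable.integral_prod_right'
            (ν := volume.restrict J)).aestronglyMeasurable ?_
          filter_upwards [hσ] with w hw
          refine norm_integral_le_of_norm_le (integrable_const _) (Eventually.of_forall fun θ => ?_)
          rw [Real.norm_of_nonneg (discPoisson_nonneg (hw.trans_lt hρ) θ)]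
          exact discPoisson_le hρ hw θ
        · filter_upwards [hσA] with w hw using half_le_integral_discPoisson (hAt hw)
  set L := 2 * (Real.pi + 1) * t with hL
  have hL0 : 0 < L := by positivity
  have hvol : volume.real J = L := by
    rw [hJ, Real.volume_real_Icc_of_le (by nlinarith)]; ring
  have hsq : N ^ 2 / (4 * L) ≤ ∫ θ, B θ * B θ ∂τ := by
    set a := N / (2 * L) with ha
    have h1 : ∫ θ in J, (2 * a * B θ - a ^ 2) ≤ ∫ θ in J, B θ * B θ := by
      refine integral_mono ?_ ?_ fun θ => by nlinarith [sq_nonneg (B θ - a)]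
      · rw [← hτJ]
        exact (hBi1.restrict.const_mul _).sub (integrable_const _)
      · rw [← hτJ]; exact hBi.restrict
    have h2 : ∫ θ in J, B θ * B θ ≤ ∫ θ, B θ * B θ ∂τ := by
      rw [← hτJ]
      exact setIntegral_le_integral hBi (Eventually.of_forall fun θ => mul_self_nonneg _)
    refine le_trans ?_ (h1.trans h2)
    have hi : Integrable B (volume.restrict J) := by rw [← hτJ]; exact hBi1.restrict
    rw [integral_sub (hi.const_mul _) (integrable_const _), integral_const_mul, setIntegral_const,
      hvol, smul_eq_mul]
    have ha0 : 0 ≤ a := by positivity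
    have h3 : 2 * a * (N / 2) ≤ 2 * a * ∫ θ in J, B θ := by gcongr
    have h4 : N ^ 2 / (4 * L) = 2 * a * (N / 2) - L * a ^ 2 := by
      rw [ha]; field_simp; ring
    linarith
  have hN0 : 0 ≤ N := measureReal_nonneg
  rcases hN0.eq_or_lt with h | h
  · rw [← h]
    positivity
  · have h1 := hsq.trans hup
    rw [div_le_iff₀ (by positivity)] at h1
    have h2 : N * N ≤ N * (16 * Real.pi * (Real.pi + 1) * ε * t) := by rw [hL] at h1; nlinarith
    exact le_of_mul_le_mul_left h2 h

theorem measurableSet_carlesonSquare {θ₀ t : ℝ} (ht : t ≤ 1) :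
    MeasurableSet (carlesonSquare θ₀ t) := by
  have hK : IsCompact ((fun p : ℝ × ℝ => (p.1 : ℂ) * circlePt p.2) ''
      (Icc (1 - t) 1 ×ˢ Icc (θ₀ - Real.pi * t) (θ₀ + Real.pi * t))) := by
    refine (isCompact_Icc.prod isCompact_Icc).image ?_
    fun_prop
  have hdisc : MeasurableSet unitDisc := by
    have : unitDisc = Metric.ball 0 1 := by ext z; simp [unitDisc]
    rw [this]; exact measurableSet_ball
  convert hK.measurableSet.inter hdisc using 1
  ext z
  constructor
  · rintro ⟨hz, hzt, θ, hθ, hzθ⟩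
    have hz' : ‖z‖ < 1 := hz
    obtain ⟨h1, h2⟩ := abs_le.1 hθ
    exact ⟨⟨(‖z‖, θ), ⟨⟨hzt, hz'.le⟩, by simp only; linarith, by simp only; linarith⟩, hzθ.symm⟩, hz⟩
  · rintro ⟨⟨⟨r, θ⟩, ⟨⟨hr1, hr2⟩, hθ1, hθ2⟩, rfl⟩, hz⟩
    simp only at hr1 hr2 hθ1 hθ2
    have hn : ‖(r : ℂ) * circlePt θ‖ = r := by
      rw [norm_mul, norm_circlePt, mul_one, Complex.norm_real, Real.norm_of_nonneg (by linarith)]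
    refine ⟨hz, by rw [hn]; exact hr1, θ, abs_le.2 ⟨by linarith, by linarith⟩, ?_⟩
    simp only [hn]

theorem differentiableOn_integral_polarHerglotz {ν : Measure ℂ} [IsFiniteMeasure ν] {ρ : ℝ}
    (hρ0 : 0 ≤ ρ) (hρ : ρ < 1) (hν : ∀ᵐ w ∂ν, ‖w‖ ≤ ρ) :
    DifferentiableOn ℂ (fun z => ∫ w, polarHerglotz z w ∂ν) (Metric.ball 0 (2 / (1 + ρ))) := by
  set c := ρ * (2 / (1 + ρ)) with hc
  have hc1 : c < 1 := by rw [hc, ← mul_div_assoc, div_lt_one (by positivity)]; linarith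
  have hle : ∀ {w z : ℂ}, ‖w‖ ≤ ρ → z ∈ Metric.ball (0 : ℂ) (2 / (1 + ρ)) → ‖w‖ * ‖z‖ ≤ c :=
    fun hw hz => mul_le_mul hw (mem_ball_zero_iff.1 hz).le (norm_nonneg _) hρ0
  intro z₀ hz₀
  refine DifferentiableAt.differentiableWithinAt
    (hasDerivAt_integral_of_dominated_loc_of_deriv_le (Metric.isOpen_ball.mem_nhds hz₀)
      (bound := fun _ => 2 / (1 - c) ^ 2)
      (F' := fun z w => 2 * (starRingEnd ℂ) w / (1 - (starRingEnd ℂ) w * z) ^ 2)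
      ?_ ?_ ?_ ?_ ?_ ?_).2.differentiableAt
  · exact Eventually.of_forall fun z => (measurable_polarHerglotz z).aestronglyMeasurable
  · refine Integrable.of_bound (measurable_polarHerglotz z₀).aestronglyMeasurable (2 / (1 - c)) ?_
    filter_upwards [hν] with w hw using norm_polarHerglotz_le hc1 (hle hw hz₀)
  · exact Measurable.aestronglyMeasurable (by fun_prop)
  · filter_upwards [hν] with w hw z hz
    rw [norm_div, norm_mul, norm_pow, RCLike.norm_conj, Complex.norm_ofNat]
    have h1 := one_sub_le_norm_one_sub_conj_mul (hle hw hz)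
    have h2 : 0 < 1 - c := by linarith
    refine div_le_div₀ zero_le_two ?_ (by positivity) (pow_le_pow_left₀ h2.le h1 2)
    linarith
  · exact integrable_const _
  · filter_upwards [hν] with w hw z hz
    have h1 := one_sub_le_norm_one_sub_conj_mul (hle hw hz)
    exact hasDerivAt_polarHerglotz (norm_pos_iff.1 (by linarith))

/-- A function with small imaginary part whose real part is large where the potential of `ν` is
large. -/
theorem exists_small_im_large_re {ν : Measure ℂ} [IsFiniteMeasure ν] {ρ η κ : ℝ}
    (hρ0 : 0 ≤ ρ) (hρ : ρ < 1) (hν : ∀ᵐ w ∂ν, ‖w‖ ≤ ρ) (hη : 0 < η) (hνη : ν.real univ ≤ η)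
    (hκ : 0 < κ) :
    ∃ R, 1 < R ∧ ∃ F : ℂ → ℂ, DifferentiableOn ℂ F (Metric.ball 0 R) ∧
      (∀ z ∈ Metric.ball 0 R, 0 ≤ (F z).re) ∧
      (∀ z ∈ Metric.ball 0 R, |(F z).im| ≤ κ * Real.pi) ∧
      (F 0).im = 0 ∧ (F 0).re ≤ κ ∧
      ∀ z ∈ Metric.ball 0 R, ∀ ε, 0 < ε → ε ≤ ∫ w, (polarHerglotz z w).re ∂ν →
        κ * Real.log (ε / η) ≤ (F z).re := by
  set R := 2 / (1 + ρ) with hRdef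
  have hR : 1 < R := by rw [hRdef, lt_div_iff₀ (by positivity)]; linarith
  set c := ρ * R with hc
  have hc1 : c < 1 := by rw [hc, hRdef, ← mul_div_assoc, div_lt_one (by positivity)]; linarith
  have hle : ∀ {w z : ℂ}, ‖w‖ ≤ ρ → z ∈ Metric.ball (0 : ℂ) R → ‖w‖ * ‖z‖ ≤ c :=
    fun hw hz => mul_le_mul hw (mem_ball_zero_iff.1 hz).le (norm_nonneg _) hρ0
  set G : ℂ → ℂ := fun z => (η⁻¹ : ℝ) * ∫ w, polarHerglotz z w ∂ν with hG
  have hGd : DifferentiableOn ℂ G (Metric.ball 0 R) :=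
    (differentiableOn_integral_polarHerglotz hρ0 hρ hν).const_mul _
  have hGre : ∀ z ∈ Metric.ball (0 : ℂ) R, (G z).re = η⁻¹ * ∫ w, (polarHerglotz z w).re ∂ν := by
    intro z hz
    have hi : Integrable (polarHerglotz z) ν := by
      refine Integrable.of_bound (measurable_polarHerglotz z).aestronglyMeasurable (2 / (1 - c)) ?_
      filter_upwards [hν] with w hw using norm_polarHerglotz_le hc1 (hle hw hz)
    rw [hG, Complex.re_ofReal_mul]
    congr 1
    exact (integral_re hi).symm
  have hGre0 : ∀ z ∈ Metric.ball (0 : ℂ) R, 0 ≤ (G z).re := by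
    intro z hz
    rw [hGre z hz]
    refine mul_nonneg (by positivity) (integral_nonneg_of_ae ?_)
    filter_upwards [hν] with w hw
    exact re_polarHerglotz_nonneg ((hle hw hz).trans hc1.le)
  have hre1 : ∀ z ∈ Metric.ball (0 : ℂ) R, 1 + (G z).re ≤ ‖1 + G z‖ := fun z _ => by
    simpa using Complex.re_le_norm (1 + G z)
  have hG0 : G 0 = ((η⁻¹ * ν.real univ : ℝ) : ℂ) := by
    simp [hG, polarHerglotz]
  refine ⟨R, hR, fun z => (κ : ℂ) * Complex.log (1 + G z), ?_, ?_, ?_, ?_, ?_, ?_⟩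
  · refine DifferentiableOn.const_mul (DifferentiableOn.clog (hGd.const_add 1) fun z hz => ?_) _
    refine Or.inl ?_
    have := hGre0 z hz
    simp only [Complex.add_re, Complex.one_re]; linarith
  · intro z hz
    rw [Complex.re_ofReal_mul, Complex.log_re]
    exact mul_nonneg hκ.le (Real.log_nonneg (by linarith [hre1 z hz, hGre0 z hz]))
  · intro z hz
    rw [Complex.im_ofReal_mul, Complex.log_im, abs_mul, abs_of_pos hκ]
    gcongr
    exact Complex.abs_arg_le_pi _
  · have : 0 ≤ 1 + η⁻¹ * ν.real univ := by positivity
    dsimp only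
    rw [hG0, Complex.im_ofReal_mul, ← Complex.ofReal_one, ← Complex.ofReal_add,
      ← Complex.ofReal_log this, Complex.ofReal_im, mul_zero]
  · have h1 : η⁻¹ * ν.real univ ≤ 1 := by
      rw [inv_mul_le_iff₀ hη, mul_one]; exact hνη
    have h0 : 0 ≤ η⁻¹ * ν.real univ := by positivity
    dsimp only
    rw [hG0, Complex.re_ofReal_mul, Complex.log_re, ← Complex.ofReal_one, ← Complex.ofReal_add,
      Complex.norm_real, Real.norm_of_nonneg (by linarith)]
    refine mul_le_of_le_one_right hκ.le ?_
    have := Real.log_le_sub_one_of_pos (show 0 < 1 + η⁻¹ * ν.real univ by linarith)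
    linarith
  · intro z hz ε hε hg
    rw [Complex.re_ofReal_mul, Complex.log_re]
    gcongr
    have h1 := hre1 z hz
    rw [hGre z hz] at h1
    have h2 : ε / η ≤ η⁻¹ * ∫ w, (polarHerglotz z w).re ∂ν := by
      rw [div_eq_inv_mul]; gcongr
    linarith

theorem setIntegral_angleArc_norm_le {f : ℝ → ℂ} (hper : Function.Periodic f (2 * Real.pi))
    (hf : IntegrableOn f (Ioc 0 (2 * Real.pi))) (θ₀ : ℝ) {t : ℝ} (ht : t ≤ 1) :
    ∫ θ in angleArc θ₀ t, ‖f θ‖ ≤ ∫ θ in Ioc 0 (2 * Real.pi), ‖f θ‖ := by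
  have hpi := Real.pi_pos
  have hn : Function.Periodic (fun θ => ‖f θ‖) (2 * Real.pi) := fun θ => by simp only [hper θ]
  have h := hn.intervalIntegral_add_eq 0 (θ₀ - Real.pi)
  rw [zero_add, intervalIntegral.integral_of_le (by linarith),
    intervalIntegral.integral_of_le (by linarith)] at h
  rw [h]
  refine setIntegral_mono_set ?_ (Eventually.of_forall fun θ => norm_nonneg _)
    (angleArc_subset ht).eventuallyLE
  have hi := hper.intervalIntegrable₀ (by positivity)
    ((intervalIntegrable_iff_integrableOn_Ioc_of_le (by positivity)).2 hf)
    (θ₀ - Real.pi) (θ₀ - Real.pi + 2 * Real.pi)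
  exact hi.1.norm

theorem IsVMO.comp {f : ℝ → ℂ} (hf : IsVMO f) (hre : ∀ θ, 0 ≤ (f θ).re) {φ : ℂ → ℂ}
    (hφ : Continuous φ)
    (hlip : ∀ x y : ℂ, 0 ≤ x.re → 0 ≤ y.re → ‖φ x - φ y‖ ≤ ‖x - y‖) :
    IsVMO fun θ => φ (f θ) := by
  obtain ⟨⟨hper, hint, C, hC⟩, hvan⟩ := hf
  have hint' : IntegrableOn (fun θ => φ (f θ)) (Ioc 0 (2 * Real.pi)) := by
    refine Integrable.mono' (hint.norm.add (integrable_const ‖φ 0‖))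
      (hφ.comp_aestronglyMeasurable hint.1) (Eventually.of_forall fun θ => ?_)
    have h1 := hlip (f θ) 0 (hre θ) le_rfl
    rw [sub_zero] at h1
    have h2 := norm_sub_norm_le (φ (f θ)) (φ 0)
    simp only [Pi.add_apply]
    linarith
  have hper' : Function.Periodic (fun θ => φ (f θ)) (2 * Real.pi) := fun θ => by simp only [hper θ]
  have hosc : ∀ θ₀ t, 0 < t → meanOsc (fun θ => φ (f θ)) θ₀ t ≤ 2 * meanOsc f θ₀ t := by
    intro θ₀ t ht
    have hi := Function.Periodic.integrableOn_angleArc hper hint θ₀ t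
    exact meanOsc_comp_le ht hi (hper'.integrableOn_angleArc hint' θ₀ t)
      fun θ => hlip _ _ (hre θ) (re_arcAvg_nonneg hre ht hi)
  refine ⟨⟨hper', hint', 2 * C, fun θ₀ t ht ht1 => ?_⟩, fun ε hε => ?_⟩
  · linarith [hosc θ₀ t ht, hC θ₀ t ht ht1]
  · obtain ⟨δ, hδ, h⟩ := hvan (ε / 2) (by positivity)
    exact ⟨δ, hδ, fun θ₀ t ht htδ => by linarith [hosc θ₀ t ht, h θ₀ t ht htδ]⟩

theorem norm_exp_neg_sub_le {x y : ℂ} (hx : 0 ≤ x.re) (hy : 0 ≤ y.re) :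
    ‖Complex.exp (-x) - Complex.exp (-y)‖ ≤ ‖x - y‖ := by
  have h := (convex_halfSpace_re_ge 0).norm_image_sub_le_of_norm_hasDerivWithin_le
    (f := fun z => Complex.exp (-z)) (f' := fun z => Complex.exp (-z) * -1) (C := 1)
    (fun z _ => ((hasDerivAt_neg z).cexp).hasDerivWithinAt)
    (fun z (hz : 0 ≤ z.re) => by
      rw [norm_mul, norm_neg, norm_one, mul_one, Complex.norm_exp, Complex.neg_re]
      exact Real.exp_le_one_iff.2 (by linarith)) (x := y) (y := x) hy hx
  rwa [one_mul] at h

section Series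

variable {F : ℕ → ℂ → ℂ} {R κ : ℕ → ℝ}

/-- A sequence of functions holomorphic near the closed disc, with nonnegative real part and
summably small imaginary parts. -/
structure SmallImSeq (F : ℕ → ℂ → ℂ) (R κ : ℕ → ℝ) : Prop where
  one_lt : ∀ k, 1 < R k
  pos : ∀ k, 0 < κ k
  summable : Summable κ
  differentiableOn : ∀ k, DifferentiableOn ℂ (F k) (Metric.ball 0 (R k))
  re_nonneg : ∀ k, ∀ z ∈ Metric.ball 0 (R k), 0 ≤ (F k z).re
  abs_im_le : ∀ k, ∀ z ∈ Metric.ball 0 (R k), |(F k z).im| ≤ κ k * Real.pi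
  im_zero : ∀ k, (F k 0).im = 0
  re_zero_le : ∀ k, (F k 0).re ≤ κ k

namespace SmallImSeq

theorem circlePt_mem (h : SmallImSeq F R κ) (k : ℕ) (θ : ℝ) : circlePt θ ∈ Metric.ball (0 : ℂ) (R k) := by
  rw [mem_ball_zero_iff, norm_circlePt]; exact h.one_lt k

theorem continuous_boundary (h : SmallImSeq F R κ) (k : ℕ) : Continuous fun θ => F k (circlePt θ) :=
  continuous_comp_circlePt (h.one_lt k) (h.differentiableOn k)

theorem integrableOn_boundary (h : SmallImSeq F R κ) (k : ℕ) :
    IntegrableOn (fun θ => F k (circlePt θ)) (Ioc 0 (2 * Real.pi)) :=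
  (h.continuous_boundary k).integrableOn_Icc.mono_set Ioc_subset_Icc_self

theorem integral_norm_boundary_le (h : SmallImSeq F R κ) (k : ℕ) :
    ∫ θ in Ioc 0 (2 * Real.pi), ‖F k (circlePt θ)‖ ≤ 2 * Real.pi * (1 + Real.pi) * κ k := by
  have hpi := Real.pi_pos
  have hc := h.continuous_boundary k
  have h0 := integral_discPoisson_smul (h.one_lt k) (h.differentiableOn k) (z := 0) (by simp)
  have hre : ∫ θ in (0 : ℝ)..2 * Real.pi, (F k (circlePt θ)).re = 2 * Real.pi * (F k 0).re := by
    have h1 := congrArg Complex.re h0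
    simp only [discPoisson, norm_zero, sub_zero, norm_circlePt] at h1
    norm_num at h1
    rw [← h1]
    exact Complex.reCLM.intervalIntegral_comp_comm (hc.intervalIntegrable _ _)
  rw [← intervalIntegral.integral_of_le (by positivity)]
  calc ∫ θ in (0 : ℝ)..2 * Real.pi, ‖F k (circlePt θ)‖
      ≤ ∫ θ in (0 : ℝ)..2 * Real.pi, ((F k (circlePt θ)).re + κ k * Real.pi) := by
        refine intervalIntegral.integral_mono (by positivity) (hc.norm.intervalIntegrable _ _)
          (((Complex.continuous_re.comp hc).add continuous_const).intervalIntegrable _ _)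
          fun θ => ?_
        refine (Complex.norm_le_abs_re_add_abs_im _).trans ?_
        rw [abs_of_nonneg (h.re_nonneg k _ (h.circlePt_mem k θ))]
        gcongr
        exact h.abs_im_le k _ (h.circlePt_mem k θ)
    _ = 2 * Real.pi * (F k 0).re + 2 * Real.pi * (κ k * Real.pi) := by
        have i1 : IntervalIntegrable (fun θ => (F k (circlePt θ)).re) volume 0 (2 * Real.pi) :=
          (Complex.continuous_re.comp hc).intervalIntegrable _ _
        rw [intervalIntegral.integral_add i1 (continuous_const.intervalIntegrable _ _), hre,
          intervalIntegral.integral_const, smul_eq_mul, sub_zero]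
    _ ≤ 2 * Real.pi * κ k + 2 * Real.pi * (κ k * Real.pi) := by
        gcongr
        exact h.re_zero_le k
    _ = _ := by ring

theorem summable_integral_norm_boundary (h : SmallImSeq F R κ) :
    Summable fun k => ∫ θ in Ioc 0 (2 * Real.pi), ‖F k (circlePt θ)‖ :=
  Summable.of_nonneg_of_le (fun _ => integral_nonneg fun _ => norm_nonneg _)
    h.integral_norm_boundary_le (h.summable.mul_left _)

theorem ae_summable_boundary (h : SmallImSeq F R κ) :
    ∀ᵐ θ ∂(volume.restrict (Ioc 0 (2 * Real.pi))), Summable fun k => F k (circlePt θ) := by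
  filter_upwards [ae_summable_norm h.integrableOn_boundary h.summable_integral_norm_boundary]
    with θ hθ using hθ.of_norm

theorem integrableOn_tsum_boundary (h : SmallImSeq F R κ) :
    IntegrableOn (fun θ => ∑' k, F k (circlePt θ)) (Ioc 0 (2 * Real.pi)) :=
  integrable_tsum h.integrableOn_boundary h.summable_integral_norm_boundary

theorem periodic_tsum_boundary :
    Function.Periodic (fun θ => ∑' k, F k (circlePt θ)) (2 * Real.pi) := fun θ => by
  simp only [circlePt_periodic θ]

theorem re_tsum_boundary_nonneg (h : SmallImSeq F R κ) (θ : ℝ) : 0 ≤ (∑' k, F k (circlePt θ)).re := by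
  by_cases hs : Summable fun k => F k (circlePt θ)
  · rw [Complex.re_tsum hs]
    exact tsum_nonneg fun k => h.re_nonneg k _ (h.circlePt_mem k θ)
  · rw [tsum_eq_zero_of_not_summable hs, Complex.zero_re]

theorem isVMO_tsum_boundary (h : SmallImSeq F R κ) : IsVMO fun θ => ∑' k, F k (circlePt θ) := by
  have hpi := Real.pi_pos
  have hper : ∀ k, Function.Periodic (fun θ => F k (circlePt θ)) (2 * Real.pi) := fun k θ => by
    simp only [circlePt_periodic θ]
  have hle : ∀ θ₀ t, 0 < t → t ≤ 1 →
      meanOsc (fun θ => ∑' k, F k (circlePt θ)) θ₀ t ≤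
        ∑' k, meanOsc (fun θ => F k (circlePt θ)) θ₀ t := fun θ₀ t ht ht1 => by
    refine meanOsc_tsum_le ht
      (fun k => (hper k).integrableOn_angleArc (h.integrableOn_boundary k) θ₀ t) ?_
    exact Summable.of_nonneg_of_le (fun _ => integral_nonneg fun _ => norm_nonneg _)
      (fun k => setIntegral_angleArc_norm_le (hper k) (h.integrableOn_boundary k) θ₀ ht1)
      h.summable_integral_norm_boundary
  have hbd : ∀ k θ₀ t, 0 < t → t ≤ 1 →
      meanOsc (fun θ => F k (circlePt θ)) θ₀ t ≤ 201 * (κ k * Real.pi) := fun k θ₀ t ht ht1 =>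
    meanOsc_le_of_im_le (h.one_lt k) (mul_pos (h.pos k) hpi) (h.differentiableOn k)
      (h.abs_im_le k) ht ht1
  have hsum : Summable fun k => 201 * (κ k * Real.pi) := (h.summable.mul_right _).mul_left _
  have hsmall : ∀ᶠ x : ℝ × ℝ in smallArcs, 0 < x.2 ∧ x.2 < 1 :=
    (eventually_smallArcs (p := fun _ t => 0 < t ∧ t < 1)).2 ⟨1, one_pos, fun _ _ h0 h1 => ⟨h0, h1⟩⟩
  rw [isVMO_iff]
  refine ⟨⟨periodic_tsum_boundary, h.integrableOn_tsum_boundary, ∑' k, 201 * (κ k * Real.pi),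
    fun θ₀ t ht ht1 => ?_⟩, ?_⟩
  · refine (hle θ₀ t ht ht1).trans (Summable.tsum_le_tsum (fun k => hbd k θ₀ t ht ht1) ?_ hsum)
    exact Summable.of_nonneg_of_le (fun k => meanOsc_nonneg _ θ₀ ht)
      (fun k => hbd k θ₀ t ht ht1) hsum
  · have hlim := tendsto_tsum_of_dominated_convergence (𝓕 := smallArcs)
      (f := fun (x : ℝ × ℝ) k => meanOsc (fun θ => F k (circlePt θ)) x.1 x.2)
      (g := fun _ => (0 : ℝ)) hsum
      (fun k => tendsto_meanOsc_comp_circlePt ((h.differentiableOn k).continuousOn.mono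
        (Metric.sphere_subset_closedBall.trans (Metric.closedBall_subset_ball (h.one_lt k)))))
      (by
        filter_upwards [hsmall] with x hx k
        rw [Real.norm_of_nonneg (meanOsc_nonneg _ _ hx.1)]
        exact hbd k _ _ hx.1 hx.2.le)
    rw [tsum_zero] at hlim
    refine tendsto_of_tendsto_of_tendsto_of_le_of_le' tendsto_const_nhds hlim ?_ ?_
    · filter_upwards [hsmall] with x hx using meanOsc_nonneg _ _ hx.1
    · filter_upwards [hsmall] with x hx using hle _ _ hx.1 hx.2.le

theorem hasSum_integral_mul {b : ℕ → ℝ → ℂ} {φ : ℝ → ℂ} (hφ : Continuous φ)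
    (hb : ∀ k, Continuous (b k))
    (hsum : Summable fun k => ∫ θ in Ioc 0 (2 * Real.pi), ‖b k θ‖) :
    HasSum (fun k => ∫ θ in Ioc 0 (2 * Real.pi), φ θ * b k θ)
      (∫ θ in Ioc 0 (2 * Real.pi), φ θ * ∑' k, b k θ) := by
  obtain ⟨M, hM⟩ := (isCompact_Icc (a := 0) (b := 2 * Real.pi)).exists_bound_of_continuousOn
    hφ.continuousOn
  have hint : ∀ k, IntegrableOn (fun θ => φ θ * b k θ) (Ioc 0 (2 * Real.pi)) := fun k =>
    (hφ.mul (hb k)).integrableOn_Icc.mono_set Ioc_subset_Icc_self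
  have hs : Summable fun k => ∫ θ in Ioc 0 (2 * Real.pi), ‖φ θ * b k θ‖ := by
    refine Summable.of_nonneg_of_le (fun _ => integral_nonneg fun _ => norm_nonneg _)
      (fun k => ?_) (hsum.mul_left M)
    rw [← integral_const_mul]
    have i2 : IntegrableOn (fun θ => M * ‖b k θ‖) (Ioc 0 (2 * Real.pi)) :=
      (continuous_const.mul (hb k).norm).integrableOn_Icc.mono_set Ioc_subset_Icc_self
    refine setIntegral_mono_on (hint k).norm i2 measurableSet_Ioc fun θ hθ => ?_
    rw [norm_mul]
    gcongr
    exact hM θ (Ioc_subset_Icc_self hθ)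
  have := hasSum_integral_of_summable_integral_norm hint hs
  simpa only [tsum_mul_left] using this

theorem hasSum_poisson (h : SmallImSeq F R κ) {z : ℂ} (hz : ‖z‖ < 1) :
    HasSum (fun k => 2 * Real.pi * F k z)
      (∫ θ in (0 : ℝ)..2 * Real.pi, (discPoisson z θ : ℂ) * ∑' k, F k (circlePt θ)) := by
  have := hasSum_integral_mul (Complex.continuous_ofReal.comp (continuous_discPoisson hz))
    h.continuous_boundary h.summable_integral_norm_boundary
  simp only [← intervalIntegral.integral_of_le Real.two_pi_pos.le, Function.comp_apply,
    integral_discPoisson_smul (h.one_lt _) (h.differentiableOn _) hz] at this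
  exact this

theorem summable_apply (h : SmallImSeq F R κ) {z : ℂ} (hz : ‖z‖ < 1) : Summable fun k => F k z :=
  (summable_mul_left_iff (by exact_mod_cast Real.two_pi_pos.ne')).1 (h.hasSum_poisson hz).summable

theorem integral_poisson_tsum (h : SmallImSeq F R κ) {z : ℂ} (hz : ‖z‖ < 1) :
    ∫ θ in (0 : ℝ)..2 * Real.pi, (discPoisson z θ : ℂ) * ∑' k, F k (circlePt θ) =
      2 * Real.pi * ∑' k, F k z := by
  rw [← tsum_mul_left]
  exact (h.hasSum_poisson hz).tsum_eq.symm

theorem integral_herglotz_tsum (h : SmallImSeq F R κ) {z : ℂ} (hz : ‖z‖ < 1) :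
    ∫ θ in Ioc 0 (2 * Real.pi), ((circlePt θ + z) / (circlePt θ - z)) *
      ((∑' k, F k (circlePt θ)).re : ℂ) = 2 * Real.pi * ∑' k, F k z := by
  have hφ : Continuous fun θ => (circlePt θ + z) / (circlePt θ - z) :=
    Continuous.div (by fun_prop) (by fun_prop) (circlePt_sub_ne_zero hz)
  have hb : ∀ k, Continuous fun θ => ((F k (circlePt θ)).re : ℂ) := fun k =>
    Complex.continuous_ofReal.comp (Complex.continuous_re.comp (h.continuous_boundary k))
  have hs : Summable fun k => ∫ θ in Ioc 0 (2 * Real.pi), ‖((F k (circlePt θ)).re : ℂ)‖ := by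
    refine Summable.of_nonneg_of_le (fun _ => integral_nonneg fun _ => norm_nonneg _)
      (fun k => ?_) h.summable_integral_norm_boundary
    refine integral_mono ((hb k).norm.integrableOn_Icc.mono_set Ioc_subset_Icc_self)
      (h.integrableOn_boundary k).norm fun θ => ?_
    rw [Complex.norm_real]
    exact Complex.abs_re_le_norm _
  have hsum := hasSum_integral_mul hφ hb hs
  have hc : ∫ θ in Ioc 0 (2 * Real.pi), ((circlePt θ + z) / (circlePt θ - z)) *
      ((∑' k, F k (circlePt θ)).re : ℂ) = ∫ θ in Ioc 0 (2 * Real.pi),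
      ((circlePt θ + z) / (circlePt θ - z)) * ∑' k, ((F k (circlePt θ)).re : ℂ) := by
    refine integral_congr_ae ?_
    filter_upwards [h.ae_summable_boundary] with θ hθ
    rw [Complex.re_tsum hθ, Complex.ofReal_tsum]
  rw [hc, ← hsum.tsum_eq, ← tsum_mul_left]
  refine tsum_congr fun k => ?_
  rw [← intervalIntegral.integral_of_le Real.two_pi_pos.le]
  exact integral_herglotz_mul_re (h.one_lt k) (h.differentiableOn k) (h.im_zero k) hz

theorem differentiableOn_tsum (h : SmallImSeq F R κ) : DifferentiableOn ℂ (fun z => ∑' k, F k z) (Metric.ball 0 1) := by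
  have hci : CircleIntegrable (fun ζ => ((∑' k, F k ζ).re : ℂ)) 0 1 := by
    rw [CircleIntegrable]
    simp only [circleMap_zero_one]
    rw [intervalIntegrable_iff_integrableOn_Ioc_of_le Real.two_pi_pos.le]
    exact h.integrableOn_tsum_boundary.re.ofReal
  refine (differentiableOn_circleAverage_herglotzRieszKernel_smul hci).congr fun z hz => ?_
  rw [mem_ball_zero_iff] at hz
  rw [Real.circleAverage_def, eq_inv_smul_iff₀ Real.two_pi_pos.ne',
    intervalIntegral.integral_of_le Real.two_pi_pos.le]
  simp only [circleMap_zero_one, herglotzRieszKernel, sub_zero, smul_eq_mul]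
  rw [h.integral_herglotz_tsum hz, Complex.real_smul]
  push_cast
  ring

theorem isOuter (h : SmallImSeq F R κ) : IsOuter fun z => Complex.exp (-∑' k, F k z) := by
  have hdisc : unitDisc = Metric.ball 0 1 := by ext z; simp [unitDisc]
  refine ⟨?_, fun θ => -(∑' k, F k (circlePt θ)).re, h.integrableOn_tsum_boundary.re.neg,
    fun z hz => ?_⟩
  · rw [hdisc]; exact h.differentiableOn_tsum.neg.cexp
  · have h1 := h.integral_herglotz_tsum hz
    simp only [Complex.ofReal_neg, mul_neg]
    rw [integral_neg, h1, Complex.real_smul]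
    congr 1
    have := Complex.ofReal_ne_zero.2 Real.pi_ne_zero
    push_cast
    field_simp

theorem norm_exp_neg_tsum_le (h : SmallImSeq F R κ) {z : ℂ} (hz : ‖z‖ < 1) (k : ℕ) :
    ‖Complex.exp (-∑' k, F k z)‖ ≤ Real.exp (-(F k z).re) := by
  have hs := h.summable_apply hz
  rw [Complex.norm_exp, Complex.neg_re, Complex.re_tsum hs]
  gcongr
  refine (Complex.hasSum_re hs.hasSum).summable.le_tsum k fun j _ => h.re_nonneg j z ?_
  rw [mem_ball_zero_iff]
  exact hz.trans (h.one_lt j)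

theorem norm_exp_neg_tsum_le_one (h : SmallImSeq F R κ) {z : ℂ} (hz : ‖z‖ < 1) :
    ‖Complex.exp (-∑' k, F k z)‖ ≤ 1 := by
  refine (h.norm_exp_neg_tsum_le hz 0).trans (Real.exp_le_one_iff.2 ?_)
  have := h.re_nonneg 0 z (mem_ball_zero_iff.2 (hz.trans (h.one_lt 0)))
  linarith

theorem memQA (h : SmallImSeq F R κ) : MemQA (fun z => Complex.exp (-∑' k, F k z))
    (fun θ => Complex.exp (-∑' k, F k (circlePt θ))) := by
  refine ⟨⟨h.isOuter.1, 1, fun z hz => h.norm_exp_neg_tsum_le_one hz⟩, ?_, ?_⟩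
  · have hf := ae_tendsto_integral_discPoisson_mul_complex (periodic_tsum_boundary (F := F))
      ((intervalIntegrable_iff_integrableOn_Ioc_of_le Real.two_pi_pos.le).2
        h.integrableOn_tsum_boundary)
    refine ae_restrict_of_ae ?_
    filter_upwards [hf] with θ hθ
    have hne : (2 * Real.pi : ℂ) ≠ 0 := by exact_mod_cast Real.two_pi_pos.ne'
    have h1 := (hθ.const_mul (2 * Real.pi : ℂ)⁻¹).neg.cexp
    rw [inv_mul_cancel_left₀ hne] at h1
    refine h1.congr' ?_
    filter_upwards [Ioo_mem_nhdsLT (show (0 : ℝ) < 1 by norm_num)] with r hr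
    have hz : ‖(r : ℂ) * circlePt θ‖ < 1 := by
      rw [norm_mul, norm_circlePt, mul_one]; exact norm_ofReal_lt_one hr.1.le hr.2
    rw [h.integral_poisson_tsum hz, inv_mul_cancel_left₀ hne]
  · exact h.isVMO_tsum_boundary.comp h.re_tsum_boundary_nonneg (φ := fun x => Complex.exp (-x))
      (by fun_prop) fun x y hx hy => norm_exp_neg_sub_le hx hy

theorem isVMO_log_norm (h : SmallImSeq F R κ) : IsVMO fun θ =>
    ((Real.log ‖Complex.exp (-∑' k, F k (circlePt θ))‖ : ℝ) : ℂ) := by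
  simp only [Complex.norm_exp, Real.log_exp]
  refine h.isVMO_tsum_boundary.comp h.re_tsum_boundary_nonneg
    (φ := fun x => (((-x).re : ℝ) : ℂ)) (by fun_prop) fun x y _ _ => ?_
  rw [← Complex.ofReal_sub, Complex.norm_real, ← Complex.sub_re]
  refine (Complex.abs_re_le_norm _).trans_eq ?_
  rw [neg_sub_neg, norm_sub_rev]

end SmallImSeq

end Series

theorem exists_strictMono_radii {μ : Measure ℂ} [IsFiniteMeasure μ] (hsupp : μ unitDiscᶜ = 0)
    {η : ℕ → ℝ} (hη : ∀ k, 0 < η k) :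
    ∃ r : ℕ → ℝ, StrictMono r ∧ (∀ k, 0 ≤ r k) ∧ (∀ k, r k < 1) ∧ Tendsto r atTop (𝓝 1) ∧
      ∀ k, μ.real {w | r k ≤ ‖w‖} ≤ η k := by
  set ρ : ℕ → ℝ := fun n => 1 - 1 / ((n : ℝ) + 1) with hρ
  have hmono : StrictMono ρ := fun m n hmn => by
    have : (m : ℝ) < n := by exact_mod_cast hmn
    have : 1 / ((n : ℝ) + 1) < 1 / ((m : ℝ) + 1) := by gcongr
    simp only [hρ]
    linarith
  have hlim : Tendsto ρ atTop (𝓝 1) := by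
    simpa [hρ] using tendsto_one_div_add_atTop_nhds_zero_nat.const_sub (1 : ℝ)
  have hmeas : Tendsto (fun n => μ {w | ρ n ≤ ‖w‖}) atTop (𝓝 0) := by
    have hzero : μ (⋂ n, {w : ℂ | ρ n ≤ ‖w‖}) = 0 := by
      refine measure_mono_null (fun w hw => ?_) hsupp
      simp only [mem_iInter, mem_ofPred_eq] at hw
      simpa [unitDisc] using le_of_tendsto' hlim hw
    rw [← hzero]
    refine tendsto_measure_iInter_atTop
      (fun n => (measurableSet_le measurable_const measurable_norm).nullMeasurableSet)
      (fun m n hmn w hw => (hmono.monotone hmn).trans hw) ⟨0, measure_ne_top _ _⟩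
  have hreal : Tendsto (fun n => μ.real {w | ρ n ≤ ‖w‖}) atTop (𝓝 0) :=
    (ENNReal.tendsto_toReal ENNReal.zero_ne_top).comp hmeas
  obtain ⟨φ, hφ, hφη⟩ := extraction_forall_of_eventually
    fun k => hreal.eventually_le_const (hη k)
  refine ⟨ρ ∘ φ, hmono.comp hφ, fun k => ?_, fun k => ?_, hlim.comp hφ.tendsto_atTop, hφη⟩
  · simpa [hρ] using inv_le_one_of_one_le₀ (by simp : (1 : ℝ) ≤ (φ k : ℝ) + 1)
  · simp only [hρ, Function.comp_apply]
    have : 0 < 1 / ((φ k : ℝ) + 1) := by positivity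
    linarith

theorem measurable_integral_polarHerglotz_re (ν : Measure ℂ) [IsFiniteMeasure ν] :
    Measurable fun z => ∫ w, (polarHerglotz z w).re ∂ν := by
  have : Measurable fun p : ℂ × ℂ => (polarHerglotz p.1 p.2).re := by
    unfold polarHerglotz
    fun_prop
  exact this.stronglyMeasurable.integral_prod_right'.measurable

theorem setLIntegral_norm_le_of_potential {μ : Measure ℂ} [IsFiniteMeasure μ] {S : Set ℂ}
    (hS : MeasurableSet S) {ρ : ℝ} (hρ : ρ < 1) (hSρ : ∀ z ∈ S, ‖z‖ ≤ ρ) {E : ℂ → ℂ} {ε b : ℝ}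
    (hε : 0 ≤ ε) (hE1 : ∀ z ∈ unitDisc, ‖E z‖ ≤ 1)
    (hEb : ∀ z ∈ unitDisc, ε ≤ ∫ w, (polarHerglotz z w).re ∂(μ.restrict S) → ‖E z‖ ≤ b)
    {θ₀ t : ℝ} (ht : 0 < t) (ht1 : t ≤ 1 / 2) :
    ∫⁻ z in S ∩ carlesonSquare θ₀ t, ENNReal.ofReal ‖E z‖ ∂μ ≤
      ENNReal.ofReal (16 * Real.pi * (Real.pi + 1) * ε * t) +
        ENNReal.ofReal b * μ (S ∩ carlesonSquare θ₀ t) := by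
  have hQ : MeasurableSet (carlesonSquare θ₀ t) := measurableSet_carlesonSquare (by linarith)
  set G : Set ℂ := {z | ∫ w, (polarHerglotz z w).re ∂(μ.restrict S) ≤ ε} with hG
  have hGm : MeasurableSet G :=
    measurableSet_le (measurable_integral_polarHerglotz_re _) measurable_const
  have hSQ := hS.inter hQ
  rw [← lintegral_inter_add_sdiff _ (S ∩ carlesonSquare θ₀ t) hGm]
  refine add_le_add ?_ ?_
  · calc ∫⁻ z in S ∩ carlesonSquare θ₀ t ∩ G, ENNReal.ofReal ‖E z‖ ∂μ
        ≤ ∫⁻ _ in S ∩ carlesonSquare θ₀ t ∩ G, 1 ∂μ :=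
          setLIntegral_mono' (hSQ.inter hGm) fun z hz =>
            ENNReal.ofReal_le_one.2 (hE1 z hz.1.2.1)
      _ = (μ.restrict S) (S ∩ carlesonSquare θ₀ t ∩ G) := by
          rw [setLIntegral_one, Measure.restrict_apply (hSQ.inter hGm),
            inter_eq_left.2 (inter_subset_left.trans inter_subset_left)]
      _ = ENNReal.ofReal ((μ.restrict S).real (S ∩ carlesonSquare θ₀ t ∩ G)) := by
          rw [ofReal_measureReal]
      _ ≤ _ := ENNReal.ofReal_le_ofReal <|
          measureReal_le_of_potential_le hρ ((ae_restrict_iff' hS).2 (ae_of_all _ hSρ)) hε ht ht1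
            (hSQ.inter hGm) (fun z hz => hz.1.2) fun z hz => hz.2
  · calc ∫⁻ z in (S ∩ carlesonSquare θ₀ t) \ G, ENNReal.ofReal ‖E z‖ ∂μ
        ≤ ∫⁻ _ in (S ∩ carlesonSquare θ₀ t) \ G, ENNReal.ofReal b ∂μ :=
          setLIntegral_mono' (hSQ.diff hGm) fun z hz =>
            ENNReal.ofReal_le_ofReal (hEb z hz.1.2.1 (not_le.1 hz.2).le)
      _ = ENNReal.ofReal b * μ ((S ∩ carlesonSquare θ₀ t) \ G) := setLIntegral_const _ _
      _ ≤ _ := by gcongr; exact sdiff_subset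

theorem exists_mem_Ico_of_tendsto {r : ℕ → ℝ} (hr : Tendsto r atTop (𝓝 1)) {x : ℝ} (hx : x < 1)
    {m : ℕ} (hm : r m ≤ x) : ∃ k, x ∈ Ico (r (k + m)) (r (k + m + 1)) := by
  by_contra! H
  have hle : ∀ k, r (k + m) ≤ x := fun k => by
    induction k with
    | zero => simpa using hm
    | succ k ih =>
      have := H k
      rw [mem_Ico, not_and, not_lt] at this
      simpa [add_right_comm] using this ih
  exact hx.not_ge (le_of_tendsto' ((tendsto_add_atTop_iff_nat m).2 hr) hle)

theorem isVanishingCarleson_absDensity {μ : Measure ℂ} [IsFiniteMeasure μ] (hμ : IsCarleson μ)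
    {r : ℕ → ℝ} (hr : StrictMono r) (hr1 : ∀ k, r k < 1) (hlim : Tendsto r atTop (𝓝 1))
    {E : ℂ → ℂ} (hE1 : ∀ z ∈ unitDisc, ‖E z‖ ≤ 1)
    (hE : ∀ k : ℕ, ∀ z ∈ unitDisc,
      (1 / 2 : ℝ) ^ k ≤ ∫ w, (polarHerglotz z w).re
        ∂(μ.restrict ((‖·‖) ⁻¹' Ico (r k) (r (k + 1)))) → ‖E z‖ ≤ Real.exp (-k)) :
    IsVanishingCarleson (absDensity E μ) := by
  obtain ⟨C, hC, hμC⟩ := hμ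
  set K : ℝ := 16 * Real.pi * (Real.pi + 1) with hK
  have hK0 : 0 ≤ K := by positivity
  have hdens : ∀ θ₀ t : ℝ, t ≤ 1 → absDensity E μ (carlesonSquare θ₀ t) =
      ∫⁻ z in carlesonSquare θ₀ t, ENNReal.ofReal ‖E z‖ ∂μ := fun θ₀ t ht =>
    withDensity_apply _ (measurableSet_carlesonSquare ht)
  refine ⟨⟨C, hC, fun θ₀ t ht ht1 => ?_⟩, fun ε hε => ?_⟩
  · rw [hdens θ₀ t ht1]
    refine le_trans ?_ (hμC θ₀ t ht ht1)
    rw [← setLIntegral_one]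
    exact setLIntegral_mono' (measurableSet_carlesonSquare ht1) fun z hz =>
      ENNReal.ofReal_le_one.2 (hE1 z hz.1)
  have hsmall : Tendsto (fun m : ℕ => K * ((1 / 2 : ℝ) ^ m * 2) + Real.exp (-m) * C) atTop
      (𝓝 0) := by
    have h1 : Tendsto (fun m : ℕ => (1 / 2 : ℝ) ^ m) atTop (𝓝 0) :=
      tendsto_pow_atTop_nhds_zero_of_lt_one (by norm_num) (by norm_num)
    have h2 : Tendsto (fun m : ℕ => Real.exp (-m)) atTop (𝓝 0) :=
      Real.tendsto_exp_neg_atTop_nhds_zero.comp tendsto_natCast_atTop_atTop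
    simpa using ((h1.mul_const 2).const_mul K).add (h2.mul_const C)
  obtain ⟨m, hm⟩ := (hsmall.eventually_le_const hε).exists
  refine ⟨min (1 / 2) (1 - r m), lt_min (by norm_num) (by linarith [hr1 m]),
    fun θ₀ t ht htm => ?_⟩
  have ht2 : t ≤ 1 / 2 := (htm.trans_le (min_le_left _ _)).le
  have htr : t < 1 - r m := htm.trans_le (min_le_right _ _)
  rw [hdens θ₀ t (by linarith)]
  set Q := carlesonSquare θ₀ t with hQ
  have hQm : MeasurableSet Q := measurableSet_carlesonSquare (by linarith)
  set S : ℕ → Set ℂ := fun k => (‖·‖) ⁻¹' Ico (r (k + m)) (r (k + m + 1)) with hS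
  have hSm : ∀ k, MeasurableSet (S k) := fun k => measurable_norm measurableSet_Ico
  have hcover : Q ⊆ ⋃ k, S k ∩ Q := fun z hz => by
    obtain ⟨k, hk⟩ := exists_mem_Ico_of_tendsto hlim (x := ‖z‖) hz.1 (m := m)
      (by linarith [hz.2.1])
    exact mem_iUnion.2 ⟨k, hk, hz⟩
  have hdisj : Pairwise (Function.onFun Disjoint fun k => S k ∩ Q) := fun i j hij => by
    have := hr.monotone.pairwise_disjoint_on_Ico_succ
      (show i + m ≠ j + m from fun h => hij (Nat.add_right_cancel h))
    exact (Disjoint.preimage _ this).mono inter_subset_left inter_subset_left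
  have hgeom : HasSum (fun k : ℕ => K * (1 / 2 : ℝ) ^ (k + m) * t)
      (K * ((1 / 2 : ℝ) ^ m * 2) * t) := by
    have := (hasSum_geometric_two.mul_left ((1 / 2 : ℝ) ^ m)).mul_left K |>.mul_right t
    simpa only [pow_add, mul_comm ((1 / 2 : ℝ) ^ m)] using this
  calc ∫⁻ z in Q, ENNReal.ofReal ‖E z‖ ∂μ
      ≤ ∫⁻ z in ⋃ k, S k ∩ Q, ENNReal.ofReal ‖E z‖ ∂μ := lintegral_mono_set hcover
    _ ≤ ∑' k, ∫⁻ z in S k ∩ Q, ENNReal.ofReal ‖E z‖ ∂μ := lintegral_iUnion_le _ _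
    _ ≤ ∑' k : ℕ, (ENNReal.ofReal (K * (1 / 2 : ℝ) ^ (k + m) * t) +
          ENNReal.ofReal (Real.exp (-m)) * μ (S k ∩ Q)) := by
        refine ENNReal.tsum_le_tsum fun k => ?_
        refine setLIntegral_norm_le_of_potential (hSm k) (hr1 (k + m + 1)) (fun z hz => hz.2.le)
          (by positivity) hE1 (fun z hz hle => (hE (k + m) z hz hle).trans ?_) ht ht2
        gcongr
        exact Nat.le_add_left m k
    _ = ENNReal.ofReal (K * ((1 / 2 : ℝ) ^ m * 2) * t) +
          ENNReal.ofReal (Real.exp (-m)) * μ (⋃ k, S k ∩ Q) := by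
        rw [ENNReal.tsum_add, ENNReal.tsum_mul_left,
          measure_iUnion hdisj fun k => (hSm k).inter hQm,
          ← ENNReal.ofReal_tsum_of_nonneg (fun k => by positivity) hgeom.summable, hgeom.tsum_eq]
    _ ≤ ENNReal.ofReal (K * ((1 / 2 : ℝ) ^ m * 2) * t) +
          ENNReal.ofReal (Real.exp (-m)) * ENNReal.ofReal (C * t) := by
        gcongr
        exact (measure_mono (iUnion_subset fun k => inter_subset_right)).trans
          (hμC θ₀ t ht (by linarith))
    _ = ENNReal.ofReal ((K * ((1 / 2 : ℝ) ^ m * 2) + Real.exp (-m) * C) * t) := by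
        rw [← ENNReal.ofReal_mul (by positivity), ← ENNReal.ofReal_add (by positivity)
          (by positivity)]
        ring_nf
    _ ≤ ENNReal.ofReal (ε * t) := by gcongr

/-- Theorem 1(a): for any Carleson measure `μ` on the unit disc there is an outer
function `E ∈ QA` with `log|E| ∈ VMO` such that `|E|μ` is a vanishing Carleson measure. -/
theorem stmt_0 (μ : Measure ℂ) [IsFiniteMeasure μ] (hsupp : μ unitDiscᶜ = 0)
    (hμ : IsCarleson μ) :
    ∃ (E : ℂ → ℂ) (Eb : ℝ → ℂ), IsOuter E ∧ MemQA E Eb ∧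
      IsVMO (fun θ => ((Real.log ‖Eb θ‖ : ℝ) : ℂ)) ∧
      IsVanishingCarleson (absDensity E μ) := by
  set κ : ℕ → ℝ := fun k => (1 / 2) ^ k with hκ
  have hκ0 : ∀ k, 0 < κ k := fun k => by positivity
  set η : ℕ → ℝ := fun k => κ k * Real.exp (-(k / κ k)) with hη
  have hη0 : ∀ k, 0 < η k := fun k => by have := hκ0 k; positivity
  obtain ⟨r, hr, hr0, hr1, hlim, hrη⟩ := exists_strictMono_radii hsupp hη0
  have hS : ∀ k, MeasurableSet ((‖·‖) ⁻¹' Ico (r k) (r (k + 1)) : Set ℂ) :=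
    fun k => measurable_norm measurableSet_Ico
  choose R hR F hFd hF0 hFim hFz hFk hFlog using fun k => exists_small_im_large_re
    (ν := μ.restrict ((‖·‖) ⁻¹' Ico (r k) (r (k + 1)))) (hr0 (k + 1)) (hr1 (k + 1))
    ((ae_restrict_iff' (hS k)).2 (ae_of_all _ fun z hz => hz.2.le)) (hη0 k)
    (by
      rw [measureReal_restrict_apply_univ]
      exact (measureReal_mono fun z hz => hz.1).trans (hrη k))
    (hκ0 k)
  have hF : SmallImSeq F R κ :=
    ⟨hR, hκ0, summable_geometric_two, hFd, hF0, hFim, hFz, hFk⟩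
  refine ⟨_, _, hF.isOuter, hF.memQA, hF.isVMO_log_norm,
    isVanishingCarleson_absDensity hμ hr hr1 hlim (fun z hz => hF.norm_exp_neg_tsum_le_one hz)
      fun k z hz hle => (hF.norm_exp_neg_tsum_le hz k).trans ?_⟩
  have hlog : κ k * Real.log (κ k / η k) = k := by
    have : κ k / η k = Real.exp (k / κ k) := by
      simp only [hη]
      rw [div_mul_cancel_left₀ (hκ0 k).ne', Real.exp_neg, inv_inv]
    rw [this, Real.log_exp, mul_div_cancel₀ _ (hκ0 k).ne']
  have := hFlog k z (mem_ball_zero_iff.2 (hz.trans (hR k))) (κ k) (hκ0 k) hle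
  rw [hlog] at this
  gcongr
end
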